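/- arXiv:1501.07378 — 2 statements merged into one kernel-verified Lean document; each statement's English description precedes it below -/
import Mathlib

section
/- For μ = (μ_1, μ_2), the Gauss decomposition blocks of the super Yangian satisfy (u-v)[E_{1;i,j}(u), F_{1;h,k}(v)] = (-1)^{|h|_2|i|_1 + |i|_1|j|_2 + |h|_2|j|_2} D_{2;h,j}(u) D'_{1;i,k}(u) - (-1)^{|h|_2|k|_1 + |j|_2|k|_1 + |h|_2|j|_2} D'_{1;i,k}(v) D_{2;h,j}(v), for all 1 ≤ i ≤ μ_1, 1 ≤ j ≤ μ_2, 1 ≤ h ≤ μ_2, 1 ≤ k ≤ μ_1. -/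
noncomputable section

namespace SuperYangian

/-- The sign `(-1)^x` for `x : ZMod 2`. -/
def sgn (x : ZMod 2) : ℂ := if x = 0 then 1 else -1

variable {A : Type*}

/-- The supercommutator `[x, y] = x*y - ε • (y*x)` with prescribed sign `ε`
(for homogeneous `x`, `y` one takes `ε = (-1)^{|x||y|}`). -/
def scomm [Ring A] [Algebra ℂ A] (ε : ℂ) (x y : A) : A := x * y - ε • (y * x)

/-- `off μ a = μ 0 + ⋯ + μ (a-1)`. -/
def off (μ : ℕ → ℕ) (a : ℕ) : ℕ := ∑ b ∈ Finset.range a, μ b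

/-- A family `t i j r` (the coefficient of `u^{-r}` in `t_{ij}(u)`, with 0-based
indices `i j < d`) satisfying the defining RTT relations of the super Yangian
`Y(gl_{M|N})` with parity sequence `p`; the super Yangian itself, via
`t_{i+1,j+1}^{(r)} = t i j r`, is the universal such family. -/
structure RTT (A : Type*) [Ring A] [Algebra ℂ A] (d : ℕ) (p : ℕ → ZMod 2) where
  t : ℕ → ℕ → ℕ → A
  t_zero : ∀ i j, t i j 0 = if i = j then (1 : A) else 0
  rtt : ∀ i j h k r s : ℕ, i < d → j < d → h < d → k < d →
    scomm (sgn ((p i + p j) * (p h + p k))) (t i j r) (t h k s) =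
      sgn (p i * p j + p i * p h + p j * p h) •
        ∑ g ∈ Finset.range (min r s),
          (t h j g * t i k (r + s - 1 - g) - t h j (r + s - 1 - g) * t i k g)

/-- Gauss decomposition data `T(u) = F(u) D(u) E(u)` with respect to the composition
`μ = (μ 0, …, μ (n-1))`, in coefficient form.  `E a b i j r` is the coefficient of
`u^{-r}` in the `(i,j)`-entry of the block `E_{a,b}(u)` (0-based blocks and entries),
extended by the identity on the diagonal blocks and by `0` below them; similarly `F`.
`D a` are the diagonal blocks and `D' a` their inverses.  Since the Gauss
decomposition is unique, this data consists exactly of the quasideterminant blocks. -/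
structure Gauss [Ring A] [Algebra ℂ A] (T : ℕ → ℕ → ℕ → A) (n : ℕ) (μ : ℕ → ℕ) where
  D : ℕ → ℕ → ℕ → ℕ → A
  D' : ℕ → ℕ → ℕ → ℕ → A
  E : ℕ → ℕ → ℕ → ℕ → ℕ → A
  F : ℕ → ℕ → ℕ → ℕ → ℕ → A
  E_diag : ∀ a i j r, E a a i j r = if i = j ∧ r = 0 then 1 else 0
  E_low : ∀ a b i j r, b < a → E a b i j r = 0
  E_zero : ∀ a b i j, a < b → E a b i j 0 = 0
  F_diag : ∀ a i j r, F a a i j r = if i = j ∧ r = 0 then 1 else 0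
  F_high : ∀ a b i j r, a < b → F a b i j r = 0
  F_zero : ∀ a b i j, b < a → F a b i j 0 = 0
  D_zero : ∀ a i j, D a i j 0 = if i = j then (1 : A) else 0
  D_inv : ∀ a i j r, a < n → i < μ a → j < μ a →
    ∑ q ∈ Finset.range (μ a), ∑ e ∈ Finset.range (r + 1), D a i q e * D' a q j (r - e) =
      if i = j ∧ r = 0 then 1 else 0
  D_inv' : ∀ a i j r, a < n → i < μ a → j < μ a →
    ∑ q ∈ Finset.range (μ a), ∑ e ∈ Finset.range (r + 1), D' a i q e * D a q j (r - e) =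
      if i = j ∧ r = 0 then 1 else 0
  decomp : ∀ a b i j r, a < n → b < n → i < μ a → j < μ b →
    T (off μ a + i) (off μ b + j) r =
      ∑ c ∈ Finset.range n, ∑ q1 ∈ Finset.range (μ c), ∑ q2 ∈ Finset.range (μ c),
        ∑ e1 ∈ Finset.range (r + 1), ∑ e2 ∈ Finset.range (r + 1 - e1),
          F a c i q1 e1 * D c q1 q2 e2 * E c b q2 j (r - e1 - e2)

section Abstract

variable {S R ι κ : Type*} [CommRing S] [Ring R] [Algebra S R]

/-- The sign `(-1)^x` for `x : ZMod 2`, in an arbitrary ring. -/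
def paritySign (S : Type*) [CommRing S] (x : ZMod 2) : S := if x = 0 then 1 else -1

theorem paritySign_add (x y : ZMod 2) : paritySign S (x + y) = paritySign S x * paritySign S y := by
  rcases (by decide +revert : x = 0 ∨ x = 1) with rfl | rfl <;>
    rcases (by decide +revert : y = 0 ∨ y = 1) with rfl | rfl <;>
    simp [paritySign, show (1 + 1 : ZMod 2) = 0 from rfl]

theorem paritySign_smul (x : ZMod 2) (a : R) :
    paritySign S x • a = if x = 0 then a else -a := by
  rw [paritySign]
  split_ifs <;> simp

theorem paritySign_mul_self (x : ZMod 2) : paritySign S x * paritySign S x = 1 := by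
  rw [← paritySign_add, CharTwo.add_self_eq_zero, paritySign, if_pos rfl]

/-- The supercommutator with prescribed sign in an arbitrary commutative ring of scalars. -/
def sbr (e : S) (x y : R) : R := x * y - e • (y * x)

theorem sbr_mul_right (e₁ e₂ : S) (x y z : R) :
    sbr (e₁ * e₂) x (y * z) = sbr e₁ x y * z + e₁ • (y * sbr e₂ x z) := by
  simp only [sbr, mul_sub, sub_mul, smul_sub, mul_smul_comm, smul_mul_assoc, mul_assoc]
  module

theorem smul_sbr_mul_right (δ e₁ e₂ : S) (x y z : R) :
    δ • sbr (e₁ * e₂) x (y * z) = (δ • sbr e₁ x y) * z + e₁ • (y * (δ • sbr e₂ x z)) := by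
  rw [sbr_mul_right, smul_add, smul_mul_assoc, mul_smul_comm, smul_comm δ]

theorem sbr_mul_left (e₁ e₂ : S) (x y z : R) :
    sbr (e₁ * e₂) (x * y) z = x * sbr e₂ y z + e₂ • (sbr e₁ x z * y) := by
  simp only [sbr, mul_sub, sub_mul, smul_sub, mul_smul_comm, smul_mul_assoc, mul_assoc]
  module

theorem mul_smul_sbr (δ e₁ e₂ : S) (x y z : R) :
    x * (δ • sbr e₂ y z) = δ • sbr (e₁ * e₂) (x * y) z - e₂ • ((δ • sbr e₁ x z) * y) := by
  rw [sbr_mul_left, smul_add, smul_mul_assoc, mul_smul_comm, smul_comm δ, add_sub_cancel_right]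

theorem sbr_sub_right (e : S) (x y z : R) : sbr e x (y - z) = sbr e x y - sbr e x z := by
  simp only [sbr, mul_sub, sub_mul, smul_sub]
  abel

theorem sbr_sum_right {α : Type*} (s : Finset α) (e : S) (x : R) (y : α → R) :
    sbr e x (∑ a ∈ s, y a) = ∑ a ∈ s, sbr e x (y a) := by
  simp only [sbr, Finset.mul_sum, Finset.sum_mul, Finset.smul_sum, Finset.sum_sub_distrib]

theorem sbr_sum_left {α : Type*} (s : Finset α) (e : S) (x : R) (y : α → R) :
    sbr e (∑ a ∈ s, y a) x = ∑ a ∈ s, sbr e (y a) x := by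
  simp only [sbr, Finset.mul_sum, Finset.sum_mul, Finset.smul_sum, Finset.sum_sub_distrib]

/-- The sign of the supercommutator of the entries `(i, j)` and `(h, k)`. -/
def commSign (S : Type*) [CommRing S] (i j h k : ZMod 2) : S := paritySign S ((i + j) * (h + k))

/-- The sign on the right-hand side of the RTT relation. -/
def rttSign (S : Type*) [CommRing S] (i j h : ZMod 2) : S := paritySign S (i * j + i * h + j * h)

theorem commSign_mul_right (i j h m k : ZMod 2) :
    commSign S i j h m * commSign S i j m k = commSign S i j h k := by
  simp only [commSign, ← paritySign_add]
  congr 1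
  decide +revert

theorem commSign_swap (i j h m : ZMod 2) : commSign S i j h m = commSign S j i h m := by
  rw [commSign, commSign, add_comm i]

theorem commSign_mul_left (i q j h m : ZMod 2) :
    commSign S i q h m * commSign S q j h m = commSign S i j h m := by
  simp only [commSign, ← paritySign_add]
  congr 1
  decide +revert

theorem commSign_mul_rttSign (i j h m : ZMod 2) :
    commSign S i j h m * rttSign S i j m = rttSign S i j h := by
  simp only [commSign, rttSign, ← paritySign_add]
  congr 1
  decide +revert

theorem commSign_mul_rttSign' (i q j h : ZMod 2) :
    commSign S q j h i * rttSign S i q h = rttSign S i j h := by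
  simp only [commSign, rttSign, ← paritySign_add]
  congr 1
  decide +revert

theorem rttSign_mul_commSign (a b h j : ZMod 2) :
    rttSign S a j h * commSign S a b h j = rttSign S b j h := by
  simp only [commSign, rttSign, ← paritySign_add]
  congr 1
  decide +revert

/-- The RTT relation `(u - v) [t(u), t'(v)] = …` with `u - v` written as `δ / π`. -/
def IsRTT (p : ι → ZMod 2) (δ π : S) (t t' : ι → ι → R) : Prop :=
  ∀ i j h k, δ • sbr (commSign S (p i) (p j) (p h) (p k)) (t i j) (t' h k) =
    (π * rttSign S (p i) (p j) (p h)) • (t h j * t' i k - t' h j * t i k)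

variable [Fintype ι] {p : ι ⊕ κ → ZMod 2} {δ π : S}
  {t t' : ι ⊕ κ → ι ⊕ κ → R} {f : κ → ι → R} {w w' : ι → ι → R}

/-- The lower right block of `T` after eliminating its lower left block by the row operation
given by `f`. -/
def rowReduce (f : κ → ι → R) (t : ι ⊕ κ → ι ⊕ κ → R) (h : κ) (l : ι ⊕ κ) : R :=
  t (Sum.inr h) l - ∑ m, f h m * t (Sum.inl m) l

theorem IsRTT.sum_sbr_mul (H : IsRTT p δ π t t')
    (hf : ∀ h k, t' (Sum.inr h) (Sum.inl k) = ∑ m, f h m * t' (Sum.inl m) (Sum.inl k))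
    (i : ι ⊕ κ) (l : ι ⊕ κ) (h : κ) (k : ι) :
    ∑ m, (δ • sbr (commSign S (p i) (p l) (p (Sum.inr h)) (p (Sum.inl m))) (t i l) (f h m)) *
        t' (Sum.inl m) (Sum.inl k) =
      (π * rttSign S (p i) (p l) (p (Sum.inr h))) •
        (rowReduce f t h l * t' i (Sum.inl k) - rowReduce f t' h l * t i (Sum.inl k)) := by
  have key : ∀ m, (δ • sbr (commSign S (p i) (p l) (p (Sum.inr h)) (p (Sum.inl m)))
      (t i l) (f h m)) * t' (Sum.inl m) (Sum.inl k) =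
      δ • sbr (commSign S (p i) (p l) (p (Sum.inr h)) (p (Sum.inl k))) (t i l)
        (f h m * t' (Sum.inl m) (Sum.inl k)) -
      (π * rttSign S (p i) (p l) (p (Sum.inr h))) • (f h m *
        (t (Sum.inl m) l * t' i (Sum.inl k) - t' (Sum.inl m) l * t i (Sum.inl k))) := by
    intro m
    rw [← commSign_mul_right _ _ _ (p (Sum.inl m)) (p (Sum.inl k)), smul_sbr_mul_right, H,
      mul_smul_comm, smul_smul, mul_left_comm, commSign_mul_rttSign, add_sub_cancel_right]
  simp only [key, Finset.sum_sub_distrib, ← Finset.smul_sum, ← sbr_sum_right, ← hf]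
  rw [H, ← smul_sub]
  congr 1
  simp only [rowReduce, mul_sub, sub_mul, Finset.sum_mul, Finset.sum_sub_distrib, mul_assoc]
  abel

theorem rowReduce_inl
    (hf : ∀ h k, t' (Sum.inr h) (Sum.inl k) = ∑ m, f h m * t' (Sum.inl m) (Sum.inl k))
    (h : κ) (k : ι) : rowReduce f t' h (Sum.inl k) = 0 := by
  rw [rowReduce, hf, sub_self]

variable [DecidableEq ι]

theorem IsRTT.sbr_lower (H : IsRTT p δ π t t')
    (hf : ∀ h k, t' (Sum.inr h) (Sum.inl k) = ∑ m, f h m * t' (Sum.inl m) (Sum.inl k))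
    (hw : ∀ i j, ∑ q, t' (Sum.inl i) (Sum.inl q) * w' q j = if i = j then 1 else 0)
    (i : ι) (l : ι ⊕ κ) (h : κ) (m : ι) :
    δ • sbr (commSign S (p (Sum.inl i)) (p l) (p (Sum.inr h)) (p (Sum.inl m)))
        (t (Sum.inl i) l) (f h m) =
      (π * rttSign S (p (Sum.inl i)) (p l) (p (Sum.inr h))) •
        (rowReduce f t h l * (if i = m then 1 else 0) -
          rowReduce f t' h l * ∑ q, t (Sum.inl i) (Sum.inl q) * w' q m) := by
  have h1 := congrArg (fun X : ι → R => ∑ k, X k * w' k m)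
    (funext fun k => H.sum_sbr_mul hf (Sum.inl i) l h k)
  simp only [Finset.sum_mul, mul_assoc] at h1
  rw [Finset.sum_comm] at h1
  simp only [← Finset.mul_sum, hw, mul_ite, mul_one, mul_zero, Finset.sum_ite_eq',
    Finset.mem_univ, if_true, smul_mul_assoc, sub_mul, mul_assoc, ← Finset.smul_sum,
    Finset.sum_sub_distrib] at h1
  simpa using h1

theorem IsRTT.sbr_block (H : IsRTT p δ π t t')
    (hf : ∀ h k, t' (Sum.inr h) (Sum.inl k) = ∑ m, f h m * t' (Sum.inl m) (Sum.inl k))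
    (hw : ∀ i j, ∑ q, t' (Sum.inl i) (Sum.inl q) * w' q j = if i = j then 1 else 0)
    (i j : ι) (h k : κ) :
    δ • sbr (commSign S (p (Sum.inl i)) (p (Sum.inl j)) (p (Sum.inr h)) (p (Sum.inr k)))
        (t (Sum.inl i) (Sum.inl j)) (rowReduce f t' h (Sum.inr k)) = 0 := by
  have key : ∀ m, δ • sbr (commSign S (p (Sum.inl i)) (p (Sum.inl j)) (p (Sum.inr h))
      (p (Sum.inr k))) (t (Sum.inl i) (Sum.inl j)) (f h m * t' (Sum.inl m) (Sum.inr k)) =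
      (π * rttSign S (p (Sum.inl i)) (p (Sum.inl j)) (p (Sum.inr h))) •
        ((if i = m then rowReduce f t h (Sum.inl j) * t' (Sum.inl m) (Sum.inr k) else 0) +
          f h m * (t (Sum.inl m) (Sum.inl j) * t' (Sum.inl i) (Sum.inr k) -
            t' (Sum.inl m) (Sum.inl j) * t (Sum.inl i) (Sum.inr k))) := by
    intro m
    rw [← commSign_mul_right _ _ _ (p (Sum.inl m)) (p (Sum.inr k)), smul_sbr_mul_right, H,
      mul_smul_comm, smul_smul, mul_left_comm, commSign_mul_rttSign, H.sbr_lower hf hw,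
      rowReduce_inl hf, smul_add]
    congr 1
    rw [smul_mul_assoc]
    split_ifs <;> simp
  rw [rowReduce, sbr_sub_right, sbr_sum_right, smul_sub, Finset.smul_sum]
  simp only [key]
  rw [H, ← Finset.smul_sum, ← smul_sub]
  convert smul_zero _
  simp only [Finset.sum_add_distrib, Finset.sum_ite_eq, Finset.mem_univ, if_true, mul_sub,
    ← mul_assoc, Finset.sum_sub_distrib, ← Finset.sum_mul, ← hf, rowReduce, sub_mul]
  abel

theorem inv_mul_eq_commSign_smul {a : ι → ι → R} (q : ι → ZMod 2) {x y : ZMod 2} {g : R}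
    (hl : ∀ i j, ∑ q, w i q * a q j = if i = j then 1 else 0)
    (hr : ∀ i j, ∑ q, a i q * w q j = if i = j then 1 else 0)
    (h : ∀ i j, a i j * g = commSign S (q i) (q j) x y • (g * a i j)) (i j : ι) :
    w i j * g = commSign S (q i) (q j) x y • (g * w i j) := by
  set σ : ι → S := fun i => paritySign S (q i * (x + y)) with hσ
  have hc : ∀ i j, commSign S (q i) (q j) x y = σ i * σ j := fun i j => by
    rw [commSign, add_mul, paritySign_add]
  have hs : ∀ i, σ i * σ i = 1 := fun i => paritySign_mul_self _
  have h1 : ∑ b, ∑ c, w i b * (σ c • (a b c * g)) * w c j =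
      ∑ b, ∑ c, w i b * (σ b • (g * a b c)) * w c j := by
    refine Finset.sum_congr rfl fun b _ => Finset.sum_congr rfl fun c _ => ?_
    rw [h, hc, smul_smul, mul_left_comm, hs, mul_one]
  have h2 : ∑ b, ∑ c, w i b * (σ c • (a b c * g)) * w c j = σ i • (g * w i j) := by
    rw [Finset.sum_comm]
    simp only [mul_smul_comm, smul_mul_assoc, ← mul_assoc, ← Finset.smul_sum, ← Finset.sum_mul,
      hl]
    simp
  have h3 : ∑ b, ∑ c, w i b * (σ b • (g * a b c)) * w c j = σ j • (w i j * g) := by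
    simp only [mul_smul_comm, smul_mul_assoc, mul_assoc, ← Finset.smul_sum, ← Finset.mul_sum,
      hr]
    simp
  rw [hc, mul_comm, mul_smul, ← h2, h1, h3, smul_smul, hs, one_smul]

variable {e : ι → κ → R}

theorem IsRTT.sbr_upper_lower (H : IsRTT p δ π t t')
    (hf : ∀ h k, t' (Sum.inr h) (Sum.inl k) = ∑ m, f h m * t' (Sum.inl m) (Sum.inl k))
    (hw : ∀ i j, ∑ q, t' (Sum.inl i) (Sum.inl q) * w' q j = if i = j then 1 else 0)
    (hwl : ∀ i j, ∑ q, w i q * t (Sum.inl q) (Sum.inl j) = if i = j then 1 else 0)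
    (he : ∀ i j, t (Sum.inl i) (Sum.inr j) = ∑ q, t (Sum.inl i) (Sum.inl q) * e q j)
    {g g' : κ → κ → R}
    (hg : ∀ h j, t (Sum.inr h) (Sum.inr j) = g h j + ∑ q, t (Sum.inr h) (Sum.inl q) * e q j)
    (hg' : ∀ h j, t' (Sum.inr h) (Sum.inr j) =
      g' h j + ∑ m, f h m * t' (Sum.inl m) (Sum.inr j))
    (hwg : ∀ i k h j, w i k * g h j =
      commSign S (p (Sum.inl i)) (p (Sum.inl k)) (p (Sum.inr h)) (p (Sum.inr j)) •
        (g h j * w i k))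
    (htg : ∀ i k h j, t (Sum.inl i) (Sum.inl k) * g' h j =
      commSign S (p (Sum.inl i)) (p (Sum.inl k)) (p (Sum.inr h)) (p (Sum.inr j)) •
        (g' h j * t (Sum.inl i) (Sum.inl k)))
    (hwg' : ∀ i k h j, w' i k * g' h j =
      commSign S (p (Sum.inl i)) (p (Sum.inl k)) (p (Sum.inr h)) (p (Sum.inr j)) •
        (g' h j * w' i k))
    (i : ι) (j h : κ) (k : ι) :
    δ • sbr (commSign S (p (Sum.inl i)) (p (Sum.inr j)) (p (Sum.inr h)) (p (Sum.inl k)))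
        (e i j) (f h k) =
      π • (rttSign S (p (Sum.inl i)) (p (Sum.inr j)) (p (Sum.inr h)) • (g h j * w i k) -
        rttSign S (p (Sum.inl k)) (p (Sum.inr j)) (p (Sum.inr h)) • (w' i k * g' h j)) := by
  have hG : ∀ h j, rowReduce f t h (Sum.inr j) -
      ∑ q, rowReduce f t h (Sum.inl q) * e q j = g h j := by
    intro h j
    simp only [rowReduce, hg, he, sub_mul, Finset.sum_mul, Finset.mul_sum, Finset.sum_sub_distrib,
      mul_assoc]
    rw [Finset.sum_comm]
    abel
  have hG' : ∀ h j, rowReduce f t' h (Sum.inr j) = g' h j := fun h j => by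
    rw [rowReduce, hg', add_sub_cancel_right]
  have key : ∀ a, ∑ q, t (Sum.inl a) (Sum.inl q) *
      (δ • sbr (commSign S (p (Sum.inl q)) (p (Sum.inr j)) (p (Sum.inr h)) (p (Sum.inl k)))
        (e q j) (f h k)) =
      (π * rttSign S (p (Sum.inl a)) (p (Sum.inr j)) (p (Sum.inr h))) •
        (g h j * (if a = k then 1 else 0) -
          g' h j * ∑ b, t (Sum.inl a) (Sum.inl b) * w' b k) := by
    intro a
    have hq : ∀ q, t (Sum.inl a) (Sum.inl q) *
        (δ • sbr (commSign S (p (Sum.inl q)) (p (Sum.inr j)) (p (Sum.inr h)) (p (Sum.inl k)))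
          (e q j) (f h k)) =
        δ • sbr (commSign S (p (Sum.inl a)) (p (Sum.inr j)) (p (Sum.inr h)) (p (Sum.inl k)))
          (t (Sum.inl a) (Sum.inl q) * e q j) (f h k) -
        (π * rttSign S (p (Sum.inl a)) (p (Sum.inr j)) (p (Sum.inr h))) •
          (rowReduce f t h (Sum.inl q) * e q j * (if a = k then 1 else 0)) := by
      intro q
      rw [mul_smul_sbr δ (commSign S (p (Sum.inl a)) (p (Sum.inl q)) (p (Sum.inr h))
        (p (Sum.inl k))), commSign_mul_left, H.sbr_lower hf hw, rowReduce_inl hf]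
      split_ifs with hak
      · subst hak
        rw [smul_mul_assoc, smul_smul, mul_left_comm, commSign_mul_rttSign']
        simp
      · simp
    simp only [hq, Finset.sum_sub_distrib, ← Finset.smul_sum, ← sbr_sum_left, ← he,
      ← Finset.sum_mul]
    rw [H.sbr_lower hf hw, hG', ← smul_sub, ← hG]
    congr 1
    rw [sub_mul]
    abel
  have h1 : δ • sbr (commSign S (p (Sum.inl i)) (p (Sum.inr j)) (p (Sum.inr h))
      (p (Sum.inl k))) (e i j) (f h k) =
      ∑ a, w i a * ((π * rttSign S (p (Sum.inl a)) (p (Sum.inr j)) (p (Sum.inr h))) •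
        (g h j * (if a = k then 1 else 0) -
          g' h j * ∑ b, t (Sum.inl a) (Sum.inl b) * w' b k)) := by
    simp only [← key]
    simp only [Finset.mul_sum, ← mul_assoc]
    rw [Finset.sum_comm]
    simp only [← Finset.sum_mul, hwl]
    simp
  have h2 : ∀ a b, rttSign S (p (Sum.inl a)) (p (Sum.inr j)) (p (Sum.inr h)) •
      (g' h j * t (Sum.inl a) (Sum.inl b)) =
      rttSign S (p (Sum.inl b)) (p (Sum.inr j)) (p (Sum.inr h)) •
      (t (Sum.inl a) (Sum.inl b) * g' h j) := by
    intro a b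
    rw [htg, smul_smul, commSign_swap, rttSign_mul_commSign]
  have h3 : ∑ a, w i a * (rttSign S (p (Sum.inl a)) (p (Sum.inr j)) (p (Sum.inr h)) •
        (g' h j * ∑ b, t (Sum.inl a) (Sum.inl b) * w' b k)) =
      rttSign S (p (Sum.inl i)) (p (Sum.inr j)) (p (Sum.inr h)) • (g' h j * w' i k) := by
    simp only [Finset.mul_sum, ← mul_assoc, Finset.smul_sum, ← smul_mul_assoc, h2]
    rw [Finset.sum_comm]
    simp only [mul_smul_comm, smul_mul_assoc, ← Finset.smul_sum, ← Finset.sum_mul, hwl]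
    simp
  rw [h1, hwg', smul_smul, commSign_swap, rttSign_mul_commSign, ← h3]
  simp only [mul_smul, smul_sub, mul_sub, Finset.sum_sub_distrib, mul_smul_comm,
    ← Finset.smul_sum]
  congr 2
  simp only [mul_ite, mul_one, mul_zero, smul_ite, smul_zero, Finset.sum_ite_eq',
    Finset.mem_univ, if_true]
  rw [hwg, smul_smul, commSign_swap, rttSign_mul_commSign]

end Abstract

section TwoVariables

open PowerSeries

variable {A : Type*} [Ring A]

/-- The series `∑ f r s x^r y^s` is a power series in `y` over power series in `x`;
this embeds the series in `x`. -/
abbrev inX : A⟦X⟧ →+* A⟦X⟧⟦X⟧ := C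

/-- The embedding of the series in `y` into the series in `x` and `y`. -/
abbrev inY : A⟦X⟧ →+* A⟦X⟧⟦X⟧ := map C

/-- The coefficient of `x^r y^s`. -/
def coeff₂ (r s : ℕ) : A⟦X⟧⟦X⟧ →+ A :=
  (coeff (R := A) r).toAddMonoidHom.comp (coeff (R := A⟦X⟧) s).toAddMonoidHom

theorem coeff₂_apply (r s : ℕ) (a : A⟦X⟧⟦X⟧) : coeff₂ r s a = coeff r (coeff s a) := rfl

theorem ext₂ {a b : A⟦X⟧⟦X⟧} (h : ∀ r s, coeff₂ r s a = coeff₂ r s b) : a = b := by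
  ext s r
  exact h r s

theorem coeff₂_inX_mul_inY (r s : ℕ) (a b : A⟦X⟧) :
    coeff₂ r s (inX a * inY b) = coeff r a * coeff s b := by
  simp [coeff₂_apply, coeff_C_mul, coeff_mul_C]

theorem coeff₂_inY_mul_inX (r s : ℕ) (a b : A⟦X⟧) :
    coeff₂ r s (inY b * inX a) = coeff s b * coeff r a := by
  simp [coeff₂_apply, coeff_C_mul, coeff_mul_C]

theorem coeff₂_inX (r s : ℕ) (a : A⟦X⟧) :
    coeff₂ r s (inX a) = if s = 0 then coeff r a else 0 := by
  rw [coeff₂_apply, coeff_C]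
  split_ifs <;> simp

theorem coeff₂_inY (r s : ℕ) (a : A⟦X⟧) :
    coeff₂ r s (inY a) = if r = 0 then coeff s a else 0 := by
  rw [coeff₂_apply, coeff_map, coeff_C]

theorem inX_X_mem_center : (inX X : A⟦X⟧⟦X⟧) ∈ Subring.center A⟦X⟧⟦X⟧ := by
  rw [Subring.mem_center_iff]
  intro a
  ext s : 1
  rw [coeff_C_mul, coeff_mul_C, X_mul]

theorem X_mem_center : (X : A⟦X⟧⟦X⟧) ∈ Subring.center A⟦X⟧⟦X⟧ :=
  Subring.mem_center_iff.2 fun _ => X_mul.symm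

variable (A) in
/-- The central variable `x`. -/
def varX : Subring.center A⟦X⟧⟦X⟧ := ⟨inX X, inX_X_mem_center⟩

variable (A) in
/-- The central variable `y`. -/
def varY : Subring.center A⟦X⟧⟦X⟧ := ⟨X, X_mem_center⟩

theorem coeff₂_varX_succ (r s : ℕ) (a : A⟦X⟧⟦X⟧) :
    coeff₂ (r + 1) s (varX A • a) = coeff₂ r s a := by
  simp [Subring.smul_def, varX, coeff₂_apply, coeff_C_mul, coeff_succ_X_mul]

theorem coeff₂_varX_zero (s : ℕ) (a : A⟦X⟧⟦X⟧) : coeff₂ 0 s (varX A • a) = 0 := by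
  simp [Subring.smul_def, varX, coeff₂_apply, coeff_C_mul]

theorem coeff₂_varY_succ (r s : ℕ) (a : A⟦X⟧⟦X⟧) :
    coeff₂ r (s + 1) (varY A • a) = coeff₂ r s a := by
  simp [Subring.smul_def, varY, coeff₂_apply, coeff_succ_X_mul]

theorem coeff₂_varY_zero (r : ℕ) (a : A⟦X⟧⟦X⟧) : coeff₂ r 0 (varY A • a) = 0 := by
  simp [Subring.smul_def, varY, coeff₂_apply]

theorem eq_zero_of_sub_smul_eq_zero {a : A⟦X⟧⟦X⟧} (h : (varY A - varX A) • a = 0) :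
    a = 0 := by
  rw [sub_smul, sub_eq_zero] at h
  have h' : ∀ r s, coeff₂ r s a = 0 := by
    intro r
    induction r with
    | zero =>
      intro s
      rw [← coeff₂_varY_succ, h, coeff₂_varX_zero]
    | succ r ih =>
      intro s
      rw [← coeff₂_varY_succ, h, coeff₂_varX_succ, ih]
  exact ext₂ fun r s => by rw [h', map_zero]

variable [Algebra ℂ A]

theorem sgn_smul {B : Type*} [Ring B] [Algebra ℂ B] (x : ZMod 2) (a : B) :
    sgn x • a = if x = 0 then a else -a :=
  paritySign_smul (S := ℂ) x a

theorem map_paritySign_smul {B : Type*} [Ring B] {S : Type*} [CommRing S] [Algebra S B]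
    (φ : B →+ A) (x : ZMod 2) (a : B) : φ (paritySign S x • a) = sgn x • φ a := by
  rw [paritySign_smul, sgn_smul]
  split_ifs <;> simp

theorem coeff₂_sbr (r s : ℕ) (i j h k : ZMod 2) (a b : A⟦X⟧) :
    coeff₂ r s (sbr (commSign (Subring.center A⟦X⟧⟦X⟧) i j h k) (inX a) (inY b)) =
      scomm (sgn ((i + j) * (h + k))) (coeff r a) (coeff s b) := by
  rw [sbr, map_sub, commSign, map_paritySign_smul, coeff₂_inX_mul_inY, coeff₂_inY_mul_inX, scomm]

theorem mul_eq_commSign_smul {i j h k : ZMod 2} {a b : A⟦X⟧}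
    (H : ∀ r s, coeff r a * coeff s b = sgn ((i + j) * (h + k)) • (coeff s b * coeff r a)) :
    a * b = commSign ℂ i j h k • (b * a) := by
  ext n
  change _ = coeff n (sgn ((i + j) * (h + k)) • (b * a))
  rw [coeff_smul, coeff_mul, coeff_mul, Finset.smul_sum, ← Finset.Nat.sum_antidiagonal_swap]
  exact Finset.sum_congr rfl fun x _ => H _ _

theorem map_mul_eq_commSign_smul {B : Type*} [Ring B] {S : Type*} [CommRing S] [Algebra S B]
    (φ : A⟦X⟧ →+* B) {i j h k : ZMod 2} {a b : A⟦X⟧}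
    (H : a * b = commSign ℂ i j h k • (b * a)) :
    φ a * φ b = commSign S i j h k • (φ b * φ a) := by
  rw [← map_mul, H, commSign, commSign, paritySign_smul, paritySign_smul]
  split_ifs <;> simp

end TwoVariables

section GaussBlocks

open PowerSeries

variable {A : Type*} [Ring A] [Algebra ℂ A] {d : ℕ} {p : ℕ → ZMod 2} {μ : ℕ → ℕ}

/-- The position in the full matrix of an index of one of the two blocks. -/
def blockIndex (μ : ℕ → ℕ) : Fin (μ 0) ⊕ Fin (μ 1) → ℕ :=
  Sum.elim (fun i => i) (fun j => μ 0 + j)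

/-- The matrix `T` of generating series, indexed by the two blocks. -/
def RTT.series (S : RTT A d p) (μ : ℕ → ℕ) (i j : Fin (μ 0) ⊕ Fin (μ 1)) : A⟦X⟧ :=
  PowerSeries.mk (S.t (blockIndex μ i) (blockIndex μ j))

theorem RTT.scomm_zero_left (S : RTT A d p) {i j h k s : ℕ} (hi : i < d) (hj : j < d)
    (hh : h < d) (hk : k < d) :
    scomm (sgn ((p i + p j) * (p h + p k))) (S.t i j 0) (S.t h k s) = 0 := by
  simp [S.rtt i j h k 0 s hi hj hh hk]

theorem RTT.scomm_zero_right (S : RTT A d p) {i j h k r : ℕ} (hi : i < d) (hj : j < d)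
    (hh : h < d) (hk : k < d) :
    scomm (sgn ((p i + p j) * (p h + p k))) (S.t i j r) (S.t h k 0) = 0 := by
  simp [S.rtt i j h k r 0 hi hj hh hk]

theorem RTT.scomm_succ_sub (S : RTT A d p) {i j h k r s : ℕ} (hi : i < d) (hj : j < d)
    (hh : h < d) (hk : k < d) :
    scomm (sgn ((p i + p j) * (p h + p k))) (S.t i j (r + 1)) (S.t h k s) -
      scomm (sgn ((p i + p j) * (p h + p k))) (S.t i j r) (S.t h k (s + 1)) =
    sgn (p i * p j + p i * p h + p j * p h) •
      (S.t h j r * S.t i k s - S.t h j s * S.t i k r) := by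
  rw [S.rtt _ _ _ _ _ _ hi hj hh hk, S.rtt _ _ _ _ _ _ hi hj hh hk, ← smul_sub,
    show r + 1 + s - 1 = r + s by omega, show r + (s + 1) - 1 = r + s by omega]
  congr 1
  rcases lt_or_ge r s with hrs | hrs
  · rw [min_eq_left (by omega : r + 1 ≤ s), min_eq_left (by omega : r ≤ s + 1),
      Finset.sum_range_succ, add_sub_cancel_left, Nat.add_sub_cancel_left]
  · rw [min_eq_right (by omega : s ≤ r + 1)]
    rcases hrs.eq_or_lt with rfl | hrs
    · simp
    · rw [min_eq_right (by omega : s + 1 ≤ r), Finset.sum_range_succ, Nat.add_sub_cancel]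
      abel

theorem blockIndex_lt (hd : off μ 2 = d) (i : Fin (μ 0) ⊕ Fin (μ 1)) : blockIndex μ i < d := by
  have h : μ 0 + μ 1 = d := by simpa [off, Finset.sum_range_succ] using hd
  rcases i with i | j
  · simp only [blockIndex, Sum.elim_inl]
    omega
  · simp only [blockIndex, Sum.elim_inr]
    omega

theorem RTT.isRTT (S : RTT A d p) (hd : off μ 2 = d) :
    IsRTT (fun i => p (blockIndex μ i)) (varY A - varX A) (varX A * varY A)
      (fun i j => inX (S.series μ i j)) (fun i j => inY (S.series μ i j)) := by
  intro i j h k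
  have hi := blockIndex_lt hd i
  have hj := blockIndex_lt hd j
  have hh := blockIndex_lt hd h
  have hk := blockIndex_lt hd k
  refine ext₂ fun r s => ?_
  rw [sub_smul, mul_smul, mul_smul, map_sub]
  rcases r with _ | r <;> rcases s with _ | s
  · simp [coeff₂_varX_zero, coeff₂_varY_zero]
  · rw [coeff₂_varX_zero, coeff₂_varX_zero, coeff₂_varY_succ, coeff₂_sbr]
    simp [RTT.series, S.scomm_zero_left hi hj hh hk]
  · rw [coeff₂_varX_succ, coeff₂_varX_succ, coeff₂_varY_zero, coeff₂_varY_zero, coeff₂_sbr]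
    simp [RTT.series, S.scomm_zero_right hi hj hh hk]
  · rw [coeff₂_varX_succ, coeff₂_varX_succ, coeff₂_varY_succ, coeff₂_varY_succ, coeff₂_sbr,
      coeff₂_sbr, rttSign, map_paritySign_smul, map_sub, coeff₂_inX_mul_inY, coeff₂_inY_mul_inX]
    simp only [RTT.series, coeff_mk]
    exact S.scomm_succ_sub hi hj hh hk

variable {T : ℕ → ℕ → ℕ → A} (G : Gauss T 2 μ)

theorem Gauss.mk_eq_sum {a b i j : ℕ} (ha : a < 2) (hb : b < 2) (hi : i < μ a) (hj : j < μ b) :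
    PowerSeries.mk (T (off μ a + i) (off μ b + j)) =
      ∑ c ∈ Finset.range 2, ∑ q₁ ∈ Finset.range (μ c), ∑ q₂ ∈ Finset.range (μ c),
        PowerSeries.mk (G.F a c i q₁) *
          (PowerSeries.mk (G.D c q₁ q₂) * PowerSeries.mk (G.E c b q₂ j)) := by
  ext r
  simp only [map_sum, coeff_mk, G.decomp a b i j r ha hb hi hj, coeff_mul,
    Finset.Nat.sum_antidiagonal_eq_sum_range_succ_mk, Finset.mul_sum, mul_assoc]
  refine Finset.sum_congr rfl fun c _ => Finset.sum_congr rfl fun q₁ _ =>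
    Finset.sum_congr rfl fun q₂ _ => Finset.sum_congr rfl fun e₁ he => ?_
  rw [show (r - e₁).succ = r + 1 - e₁ by rw [Finset.mem_range] at he; omega]

theorem Gauss.mk_E_diag (a i j : ℕ) : PowerSeries.mk (G.E a a i j) = if i = j then 1 else 0 := by
  ext r
  rw [coeff_mk, G.E_diag]
  split_ifs <;> simp_all [coeff_one]

theorem Gauss.mk_F_diag (a i j : ℕ) : PowerSeries.mk (G.F a a i j) = if i = j then 1 else 0 := by
  ext r
  rw [coeff_mk, G.F_diag]
  split_ifs <;> simp_all [coeff_one]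

theorem Gauss.mk_E_low {a b : ℕ} (h : b < a) (i j : ℕ) : PowerSeries.mk (G.E a b i j) = 0 := by
  ext r
  rw [coeff_mk, G.E_low _ _ _ _ _ h, map_zero]

theorem Gauss.mk_F_high {a b : ℕ} (h : a < b) (i j : ℕ) : PowerSeries.mk (G.F a b i j) = 0 := by
  ext r
  rw [coeff_mk, G.F_high _ _ _ _ _ h, map_zero]

theorem Gauss.series₁₁ {i j : ℕ} (hi : i < μ 0) (hj : j < μ 0) :
    PowerSeries.mk (T i j) = PowerSeries.mk (G.D 0 i j) := by
  have h := G.mk_eq_sum (a := 0) (b := 0) (by omega) (by omega) hi hj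
  simpa [off, Finset.sum_range_succ, G.mk_E_diag, G.mk_F_diag, G.mk_E_low, G.mk_F_high,
    hi, hj] using h

theorem Gauss.series₁₂ {i j : ℕ} (hi : i < μ 0) (hj : j < μ 1) :
    PowerSeries.mk (T i (μ 0 + j)) =
      ∑ q ∈ Finset.range (μ 0), PowerSeries.mk (G.D 0 i q) * PowerSeries.mk (G.E 0 1 q j) := by
  have h := G.mk_eq_sum (a := 0) (b := 1) (by omega) (by omega) hi hj
  simpa [off, Finset.sum_range_succ, G.mk_E_diag, G.mk_F_diag, G.mk_E_low, G.mk_F_high,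
    hi, hj] using h

theorem Gauss.series₂₁ {i j : ℕ} (hi : i < μ 1) (hj : j < μ 0) :
    PowerSeries.mk (T (μ 0 + i) j) =
      ∑ q ∈ Finset.range (μ 0), PowerSeries.mk (G.F 1 0 i q) * PowerSeries.mk (G.D 0 q j) := by
  have h := G.mk_eq_sum (a := 1) (b := 0) (by omega) (by omega) hi hj
  simpa [off, Finset.sum_range_succ, G.mk_E_diag, G.mk_F_diag, G.mk_E_low, G.mk_F_high,
    hi, hj] using h

theorem Gauss.series₂₂ {i j : ℕ} (hi : i < μ 1) (hj : j < μ 1) :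
    PowerSeries.mk (T (μ 0 + i) (μ 0 + j)) = PowerSeries.mk (G.D 1 i j) +
      ∑ q₁ ∈ Finset.range (μ 0), ∑ q₂ ∈ Finset.range (μ 0), PowerSeries.mk (G.F 1 0 i q₁) *
        (PowerSeries.mk (G.D 0 q₁ q₂) * PowerSeries.mk (G.E 0 1 q₂ j)) := by
  have h := G.mk_eq_sum (a := 1) (b := 1) (by omega) (by omega) hi hj
  rw [add_comm (PowerSeries.mk _)]
  simpa [off, Finset.sum_range_succ, G.mk_E_diag, G.mk_F_diag, G.mk_E_low, G.mk_F_high,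
    hi, hj] using h

theorem Gauss.mk_D_mul {a i j : ℕ} (ha : a < 2) (hi : i < μ a) (hj : j < μ a) :
    ∑ q ∈ Finset.range (μ a), PowerSeries.mk (G.D a i q) * PowerSeries.mk (G.D' a q j) =
      if i = j then 1 else 0 := by
  ext r
  simp only [map_sum, coeff_mk, coeff_mul, Finset.Nat.sum_antidiagonal_eq_sum_range_succ_mk]
  rw [G.D_inv a i j r ha hi hj]
  split_ifs <;> simp_all [coeff_one]

theorem Gauss.mk_D'_mul {a i j : ℕ} (ha : a < 2) (hi : i < μ a) (hj : j < μ a) :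
    ∑ q ∈ Finset.range (μ a), PowerSeries.mk (G.D' a i q) * PowerSeries.mk (G.D a q j) =
      if i = j then 1 else 0 := by
  ext r
  simp only [map_sum, coeff_mk, coeff_mul, Finset.Nat.sum_antidiagonal_eq_sum_range_succ_mk]
  rw [G.D_inv' a i j r ha hi hj]
  split_ifs <;> simp_all [coeff_one]

section RingHom

variable (S : RTT A d p) {B : Type*} [Ring B] (φ : A⟦X⟧ →+* B)

theorem Gauss.map_lower (G : Gauss S.t 2 μ) (h : Fin (μ 1)) (k : Fin (μ 0)) :
    φ (S.series μ (Sum.inr h) (Sum.inl k)) =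
      ∑ m : Fin (μ 0), φ (PowerSeries.mk (G.F 1 0 h m)) *
        φ (S.series μ (Sum.inl m) (Sum.inl k)) := by
  simp only [RTT.series, blockIndex, Sum.elim_inl, Sum.elim_inr, G.series₂₁ h.2 k.2,
    G.series₁₁ (Fin.is_lt _) (Fin.is_lt _), Finset.sum_range, map_sum, map_mul]

theorem Gauss.map_upper (G : Gauss S.t 2 μ) (i : Fin (μ 0)) (j : Fin (μ 1)) :
    φ (S.series μ (Sum.inl i) (Sum.inr j)) =
      ∑ q : Fin (μ 0), φ (S.series μ (Sum.inl i) (Sum.inl q)) *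
        φ (PowerSeries.mk (G.E 0 1 q j)) := by
  simp only [RTT.series, blockIndex, Sum.elim_inl, Sum.elim_inr, G.series₁₂ i.2 j.2,
    G.series₁₁ (Fin.is_lt _) (Fin.is_lt _), Finset.sum_range, map_sum, map_mul]

theorem Gauss.map_mul_inv (G : Gauss S.t 2 μ) (i j : Fin (μ 0)) :
    ∑ q : Fin (μ 0), φ (S.series μ (Sum.inl i) (Sum.inl q)) * φ (PowerSeries.mk (G.D' 0 q j)) =
      if i = j then 1 else 0 := by
  simp only [RTT.series, blockIndex, Sum.elim_inl, G.series₁₁ (Fin.is_lt _) (Fin.is_lt _),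
    ← map_mul, ← map_sum]
  rw [← Finset.sum_range fun q => PowerSeries.mk (G.D 0 i q) * PowerSeries.mk (G.D' 0 q j),
    G.mk_D_mul (by omega) i.2 j.2]
  simp [Fin.ext_iff, apply_ite φ]

theorem Gauss.map_inv_mul (G : Gauss S.t 2 μ) (i j : Fin (μ 0)) :
    ∑ q : Fin (μ 0), φ (PowerSeries.mk (G.D' 0 i q)) * φ (S.series μ (Sum.inl q) (Sum.inl j)) =
      if i = j then 1 else 0 := by
  simp only [RTT.series, blockIndex, Sum.elim_inl, G.series₁₁ (Fin.is_lt _) (Fin.is_lt _),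
    ← map_mul, ← map_sum]
  rw [← Finset.sum_range fun q => PowerSeries.mk (G.D' 0 i q) * PowerSeries.mk (G.D 0 q j),
    G.mk_D'_mul (by omega) i.2 j.2]
  simp [Fin.ext_iff, apply_ite φ]

theorem Gauss.map_corner_right (G : Gauss S.t 2 μ) (h j : Fin (μ 1)) :
    φ (S.series μ (Sum.inr h) (Sum.inr j)) = φ (PowerSeries.mk (G.D 1 h j)) +
      ∑ q : Fin (μ 0), φ (S.series μ (Sum.inr h) (Sum.inl q)) *
        φ (PowerSeries.mk (G.E 0 1 q j)) := by
  simp only [RTT.series, blockIndex, Sum.elim_inl, Sum.elim_inr, G.series₂₂ h.2 j.2,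
    G.series₂₁ h.2 (Fin.is_lt _), Finset.sum_range, map_sum, map_mul, map_add,
    Finset.sum_mul, mul_assoc]
  rw [Finset.sum_comm]

theorem Gauss.map_corner_left (G : Gauss S.t 2 μ) (h j : Fin (μ 1)) :
    φ (S.series μ (Sum.inr h) (Sum.inr j)) = φ (PowerSeries.mk (G.D 1 h j)) +
      ∑ m : Fin (μ 0), φ (PowerSeries.mk (G.F 1 0 h m)) *
        φ (S.series μ (Sum.inl m) (Sum.inr j)) := by
  simp only [RTT.series, blockIndex, Sum.elim_inl, Sum.elim_inr, G.series₂₂ h.2 j.2,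
    G.series₁₂ (Fin.is_lt _) j.2, Finset.sum_range, map_sum, map_mul, map_add, Finset.mul_sum]

end RingHom

theorem Gauss.map_mul_map {S : RTT A d p} (G : Gauss S.t 2 μ)
    {Z B : Type*} [CommRing Z] [Ring B] [Algebra Z B] {δ π : Z} {φ ψ : A⟦X⟧ →+* B}
    (H : IsRTT (fun i => p (blockIndex μ i)) δ π
      (fun i j => φ (S.series μ i j)) (fun i j => ψ (S.series μ i j)))
    (hδ : ∀ x : B, δ • x = 0 → x = 0) (i j : Fin (μ 0)) (h k : Fin (μ 1)) :
    φ (PowerSeries.mk (G.D 0 i j)) * ψ (PowerSeries.mk (G.D 1 h k)) =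
      commSign Z (p i) (p j) (p (μ 0 + h)) (p (μ 0 + k)) •
        (ψ (PowerSeries.mk (G.D 1 h k)) * φ (PowerSeries.mk (G.D 0 i j))) := by
  have H' := hδ _ (H.sbr_block
    (f := fun (h : Fin (μ 1)) (k : Fin (μ 0)) => ψ (PowerSeries.mk (G.F 1 0 h k)))
    (w' := fun i j : Fin (μ 0) => ψ (PowerSeries.mk (G.D' 0 i j)))
    (G.map_lower S ψ) (G.map_mul_inv S ψ) i j h k)
  rw [rowReduce, G.map_corner_left S ψ, add_sub_cancel_right] at H'
  simp only [RTT.series, blockIndex, Sum.elim_inl, Sum.elim_inr, G.series₁₁ i.2 j.2] at H'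
  exact sub_eq_zero.1 H'

theorem Gauss.D_mul_D (S : RTT A d p) (G : Gauss S.t 2 μ) (hd : off μ 2 = d)
    (i j : Fin (μ 0)) (h k : Fin (μ 1)) :
    PowerSeries.mk (G.D 0 i j) * PowerSeries.mk (G.D 1 h k) =
      commSign ℂ (p i) (p j) (p (μ 0 + h)) (p (μ 0 + k)) •
        (PowerSeries.mk (G.D 1 h k) * PowerSeries.mk (G.D 0 i j)) := by
  refine mul_eq_commSign_smul fun r s => ?_
  have H := congrArg (coeff₂ r s)
    (G.map_mul_map (S.isRTT hd) (fun _ => eq_zero_of_sub_smul_eq_zero) i j h k)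
  rwa [commSign, map_paritySign_smul, coeff₂_inX_mul_inY, coeff₂_inY_mul_inX] at H

theorem Gauss.D'_mul_D (S : RTT A d p) (G : Gauss S.t 2 μ) (hd : off μ 2 = d)
    (i j : Fin (μ 0)) (h k : Fin (μ 1)) :
    PowerSeries.mk (G.D' 0 i j) * PowerSeries.mk (G.D 1 h k) =
      commSign ℂ (p i) (p j) (p (μ 0 + h)) (p (μ 0 + k)) •
        (PowerSeries.mk (G.D 1 h k) * PowerSeries.mk (G.D' 0 i j)) :=
  inv_mul_eq_commSign_smul (w := fun i j : Fin (μ 0) => PowerSeries.mk (G.D' 0 i j))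
    (a := fun i j : Fin (μ 0) => PowerSeries.mk (G.D 0 i j)) (fun i => p i)
    (fun i j => by
      rw [← Finset.sum_range fun q => PowerSeries.mk (G.D' 0 i q) * PowerSeries.mk (G.D 0 q j),
        G.mk_D'_mul (by omega) i.2 j.2]
      simp [Fin.ext_iff])
    (fun i j => by
      rw [← Finset.sum_range fun q => PowerSeries.mk (G.D 0 i q) * PowerSeries.mk (G.D' 0 q j),
        G.mk_D_mul (by omega) i.2 j.2]
      simp [Fin.ext_iff])
    (fun i j => G.D_mul_D S hd i j h k) i j

theorem Gauss.sbr_E_F {S : RTT A d p} (G : Gauss S.t 2 μ) (hd : off μ 2 = d)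
    {Z B : Type*} [CommRing Z] [Ring B] [Algebra Z B] {δ π : Z} {φ ψ : A⟦X⟧ →+* B}
    (H : IsRTT (fun i => p (blockIndex μ i)) δ π
      (fun i j => φ (S.series μ i j)) (fun i j => ψ (S.series μ i j)))
    (hδ : ∀ x : B, δ • x = 0 → x = 0)
    (i : Fin (μ 0)) (j h : Fin (μ 1)) (k : Fin (μ 0)) :
    δ • sbr (commSign Z (p i) (p (μ 0 + j)) (p (μ 0 + h)) (p k))
        (φ (PowerSeries.mk (G.E 0 1 i j))) (ψ (PowerSeries.mk (G.F 1 0 h k))) =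
      π • (rttSign Z (p i) (p (μ 0 + j)) (p (μ 0 + h)) •
          (φ (PowerSeries.mk (G.D 1 h j)) * φ (PowerSeries.mk (G.D' 0 i k))) -
        rttSign Z (p k) (p (μ 0 + j)) (p (μ 0 + h)) •
          (ψ (PowerSeries.mk (G.D' 0 i k)) * ψ (PowerSeries.mk (G.D 1 h j)))) := by
  refine H.sbr_upper_lower
    (e := fun (i : Fin (μ 0)) (j : Fin (μ 1)) => φ (PowerSeries.mk (G.E 0 1 i j)))
    (f := fun (h : Fin (μ 1)) (k : Fin (μ 0)) => ψ (PowerSeries.mk (G.F 1 0 h k)))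
    (w := fun i j : Fin (μ 0) => φ (PowerSeries.mk (G.D' 0 i j)))
    (w' := fun i j : Fin (μ 0) => ψ (PowerSeries.mk (G.D' 0 i j)))
    (g := fun h j : Fin (μ 1) => φ (PowerSeries.mk (G.D 1 h j)))
    (g' := fun h j : Fin (μ 1) => ψ (PowerSeries.mk (G.D 1 h j)))
    (G.map_lower S ψ) (G.map_mul_inv S ψ) (G.map_inv_mul S φ) (G.map_upper S φ)
    (G.map_corner_right S φ) (G.map_corner_left S ψ) (fun i k h j => ?_)
    (fun i k h j => ?_) (fun i k h j => ?_) i j h k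
  · exact map_mul_eq_commSign_smul (S := Z) φ (G.D'_mul_D S hd i k h j)
  · simp only [RTT.series, blockIndex, Sum.elim_inl, Sum.elim_inr, G.series₁₁ i.2 k.2]
    exact G.map_mul_map H hδ i k h j
  · exact map_mul_eq_commSign_smul (S := Z) ψ (G.D'_mul_D S hd i k h j)

end GaussBlocks

/-- For `μ = (μ 0, μ 1)`, the Gauss blocks satisfy
`(u-v)[E_{1;i,j}(u), F_{1;h,k}(v)] = (-1)^{|h|₂|i|₁+|i|₁|j|₂+|h|₂|j|₂} D_{2;h,j}(u) D'_{1;i,k}(u)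
- (-1)^{|h|₂|k|₁+|j|₂|k|₁+|h|₂|j|₂} D'_{1;i,k}(v) D_{2;h,j}(v)`, stated as the equality
of the coefficients of `u^{-r} v^{-s}` for all `r, s ≥ 0`. -/
theorem statement7 [Ring A] [Algebra ℂ A] {d : ℕ} {p : ℕ → ZMod 2} {μ : ℕ → ℕ}
    (S : RTT A d p) (G : Gauss S.t 2 μ) (hd : off μ 2 = d) :
    ∀ i j h k r s : ℕ, i < μ 0 → j < μ 1 → h < μ 1 → k < μ 0 →
      scomm (sgn ((p i + p (μ 0 + j)) * (p (μ 0 + h) + p k)))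
          (G.E 0 1 i j (r + 1)) (G.F 1 0 h k s) -
        scomm (sgn ((p i + p (μ 0 + j)) * (p (μ 0 + h) + p k)))
          (G.E 0 1 i j r) (G.F 1 0 h k (s + 1)) =
      (if s = 0 then
          sgn (p (μ 0 + h) * p i + p i * p (μ 0 + j) + p (μ 0 + h) * p (μ 0 + j)) •
            ∑ e ∈ Finset.range (r + 1), G.D 1 h j e * G.D' 0 i k (r - e)
        else 0) -
      (if r = 0 then
          sgn (p (μ 0 + h) * p k + p (μ 0 + j) * p k + p (μ 0 + h) * p (μ 0 + j)) •
            ∑ e ∈ Finset.range (s + 1), G.D' 0 i k e * G.D 1 h j (s - e)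
        else 0) := by
  intro i j h k r s hi hj hh hk
  have H := G.sbr_E_F hd (S.isRTT hd) (fun _ => eq_zero_of_sub_smul_eq_zero)
    ⟨i, hi⟩ ⟨j, hj⟩ ⟨h, hh⟩ ⟨k, hk⟩
  replace H := congrArg (coeff₂ (r + 1) (s + 1)) H
  rw [sub_smul, mul_smul, map_sub, coeff₂_varY_succ, coeff₂_varX_succ, coeff₂_varX_succ,
    coeff₂_varY_succ, coeff₂_sbr, coeff₂_sbr, map_sub, rttSign, rttSign, map_paritySign_smul,
    map_paritySign_smul, ← map_mul, ← map_mul, coeff₂_inX, coeff₂_inY] at H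
  simp only [PowerSeries.coeff_mk, PowerSeries.coeff_mul,
    Finset.Nat.sum_antidiagonal_eq_sum_range_succ_mk, smul_ite, smul_zero] at H
  rw [show p (μ 0 + h) * p i + p i * p (μ 0 + j) + p (μ 0 + h) * p (μ 0 + j) =
      p i * p (μ 0 + j) + p i * p (μ 0 + h) + p (μ 0 + j) * p (μ 0 + h) by ring,
    show p (μ 0 + h) * p k + p (μ 0 + j) * p k + p (μ 0 + h) * p (μ 0 + j) =
      p k * p (μ 0 + j) + p k * p (μ 0 + h) + p (μ 0 + j) * p (μ 0 + h) by ring]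
  exact H

end SuperYangian
end
end

section
/- For μ = (μ_1, μ_2, μ_3), in the super Yangian one has [E_{1;i,j}(u), E_{2;h,k}(v)] = (-1)^{|j|_2 |h|_2} δ_{hj} (u-v)^{-1} sum_{q=1}^{μ_2} { ( E_{1;i,q}(u) - E_{1;i,q}(v) ) E_{2;q,k}(v) } + (-1)^{|j|_2|h|_2} δ_{hj}(u-v)^{-1}( E_{1,3;i,k}(v) - E_{1,3;i,k}(u) ), for all 1 ≤ i ≤ μ_1, 1 ≤ j,h ≤ μ_2, 1 ≤ k ≤ μ_3. -/
noncomputable section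

namespace SuperYangian

variable {A : Type*}

lemma sgn_add (x y : ZMod 2) : sgn (x + y) = sgn x * sgn y := by
  have h : ∀ x : ZMod 2, x = 0 ∨ x = 1 := by decide
  have h11 : (1 + 1 : ZMod 2) = 0 := by decide
  rcases h x with rfl | rfl <;> rcases h y with rfl | rfl <;> simp [sgn, h11]

lemma sgn_mul_self (x : ZMod 2) : sgn x * sgn x = 1 := by
  rw [sgn]
  split_ifs <;> norm_num

lemma sgn_zero : sgn 0 = 1 := by simp [sgn]

section Superbracket

variable {R : Type*} [Ring R] [Algebra ℂ R]

lemma scomm_mul_right (ε δ : ℂ) (a b c : R) :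
    scomm (ε * δ) a (b * c) = scomm ε a b * c + ε • (b * scomm δ a c) := by
  simp only [scomm, sub_mul, mul_sub, smul_sub, mul_assoc, smul_mul_assoc, mul_smul_comm,
    mul_smul]
  abel

lemma scomm_mul_left (ε δ : ℂ) (a b c : R) :
    scomm (ε * δ) (a * b) c = a * scomm δ b c + δ • (scomm ε a c * b) := by
  simp only [scomm, sub_mul, mul_sub, smul_sub, mul_assoc, smul_mul_assoc, mul_smul_comm,
    mul_comm ε δ, mul_smul]
  abel

lemma scomm_sum_right {κ : Type*} (s : Finset κ) (ε : ℂ) (a : R) (f : κ → R) :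
    scomm ε a (∑ g ∈ s, f g) = ∑ g ∈ s, scomm ε a (f g) := by
  simp [scomm, Finset.mul_sum, Finset.sum_mul, Finset.smul_sum]

lemma scomm_sum_left {κ : Type*} (s : Finset κ) (ε : ℂ) (a : R) (f : κ → R) :
    scomm ε (∑ g ∈ s, f g) a = ∑ g ∈ s, scomm ε (f g) a := by
  simp [scomm, Finset.mul_sum, Finset.sum_mul, Finset.smul_sum]

lemma scomm_neg_right (ε : ℂ) (a b : R) : scomm ε a (-b) = -scomm ε a b := by
  simp only [scomm, mul_neg, neg_mul, smul_neg]
  abel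

/-- The superbracket of the generating matrix `T(u)` with a column `W(v)` of the inverse of
`T(v)`, where `z / w` plays the role of `u - v`. -/
lemma scomm_inverse_column {ι : Type*} [Fintype ι] [DecidableEq ι] (P : ι → ZMod 2) (z w : R)
    (hz : ∀ a, z * a = a * z) (hw : ∀ a, w * a = a * w) (Tu Tv : ι → ι → R)
    (hT : ∀ i j h k, z * scomm (sgn ((P i + P j) * (P h + P k))) (Tu i j) (Tv h k) =
      w * (sgn (P i * P j + P i * P h + P j * P h) •
        (Tu h j * Tv i k - Tv h j * Tu i k)))
    (W : ι → R) (k : ι) (hW : ∀ a, ∑ g, Tv a g * W g = if a = k then 1 else 0)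
    (hinj : ∀ Z : ι → R, (∀ a, ∑ g, Tv a g * Z g = 0) → ∀ g, Z g = 0)
    (i j g : ι) (hik : i ≠ k) :
    z * scomm (sgn ((P i + P j) * (P g + P k))) (Tu i j) (W g) =
      if g = j then w * (sgn (P j) • ∑ q, Tu i q * W q) else 0 := by
  set Q := ∑ q, Tu i q * W q with hQ
  have key := hinj (fun g => sgn ((P i + P j) * P g) •
      (z * scomm (sgn ((P i + P j) * (P g + P k))) (Tu i j) (W g)) -
      if g = j then w * (sgn (P i * P j) • Q) else 0) ?_ g
  · have h2 := sub_eq_zero.mp key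
    have h3 := congrArg (fun x => sgn ((P i + P j) * P g) • x) h2
    simp only [smul_smul, sgn_mul_self, one_smul] at h3
    rw [h3]
    split_ifs with hg
    · subst hg
      rw [← mul_smul_comm, smul_smul, ← sgn_add]
      congr 3
      exact (by decide : ∀ a b : ZMod 2, (a + b) * b + a * b = b) _ _
    · simp
  · intro a
    have h0 : z * scomm (sgn ((P i + P j) * (P a + P k))) (Tu i j) (∑ g, Tv a g * W g) = 0 := by
      rw [hW]
      split_ifs with h
      · subst h
        have : P a + P a = 0 := CharTwo.add_self_eq_zero _
        simp [this, sgn_zero, scomm]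
      · simp [scomm]
    have hterm : ∀ q, z * scomm (sgn ((P i + P j) * (P a + P k))) (Tu i j) (Tv a q * W q) =
        w * (sgn (P i * P j + P i * P a + P j * P a) •
          (Tu a j * (Tv i q * W q) - Tv a j * (Tu i q * W q))) +
        sgn ((P i + P j) * P a) • (Tv a q * (sgn ((P i + P j) * P q) •
          (z * scomm (sgn ((P i + P j) * (P q + P k))) (Tu i j) (W q)))) := by
      intro q
      have hs : sgn ((P i + P j) * (P a + P k)) =
          sgn ((P i + P j) * (P a + P q)) * sgn ((P i + P j) * (P q + P k)) := by
        rw [← sgn_add]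
        congr 1
        exact (by decide : ∀ a b c d : ZMod 2, a * (b + d) = a * (b + c) + a * (c + d)) _ _ _ _
      rw [hs, scomm_mul_right, mul_add, ← mul_assoc, hT]
      congr 1
      · simp only [sub_mul, smul_mul_assoc, mul_assoc]
      · rw [mul_smul_comm, mul_smul_comm, smul_smul, ← sgn_add, ← mul_add, ← mul_assoc,
          ← mul_assoc, hz]
    rw [scomm_sum_right, Finset.mul_sum, Finset.sum_congr rfl (fun q _ => hterm q),
      Finset.sum_add_distrib, ← Finset.mul_sum, ← Finset.smul_sum, ← Finset.smul_sum,
      Finset.sum_sub_distrib, ← Finset.mul_sum, ← Finset.mul_sum, hW, if_neg hik, ← hQ] at h0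
    simp only [mul_sub, Finset.sum_sub_distrib, mul_ite, mul_zero, Finset.sum_ite_eq',
      Finset.mem_univ, if_true]
    have hs : sgn (P i * P j + P i * P a + P j * P a) =
        sgn ((P i + P j) * P a) * sgn (P i * P j) := by
      rw [← sgn_add]
      congr 1
      ring
    rw [hs, mul_zero, zero_sub, mul_smul, mul_smul_comm, ← smul_add] at h0
    have h1 := congrArg (fun x => sgn ((P i + P j) * P a) • x) h0
    simp only [smul_smul, sgn_mul_self, one_smul, smul_zero] at h1
    rw [← h1, smul_neg, mul_neg, ← mul_assoc (Tv a j), ← hw, mul_assoc,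
      mul_smul_comm (_ : ℂ) (Tv a j)]
    abel

/-- A superbracket with a row `U`, recovered from those with `U * D'`, when the invertible
matrix `D'` supercommutes with the given element. -/
lemma scomm_cancel_right {κ : Type*} [Fintype κ] [DecidableEq κ] (P : κ → ZMod 2) (τ π : ZMod 2)
    (z a : R) (D D' : κ → κ → R)
    (hD : ∀ g l, ∑ k, D' g k * D k l = if g = l then 1 else 0)
    (hc : ∀ g k, scomm (sgn (τ * (P g + P k))) a (D' g k) = 0) (U Y : κ → R)
    (hY : ∀ k, z * scomm (sgn (τ * (π + P k))) a (∑ g, U g * D' g k) = Y k) (l : κ) :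
    z * scomm (sgn (τ * (π + P l))) a (U l) = ∑ k, Y k * D k l := by
  have h1 : ∀ k, Y k = ∑ g, (z * scomm (sgn (τ * (π + P g))) a (U g)) * D' g k := by
    intro k
    rw [← hY, scomm_sum_right, Finset.mul_sum]
    refine Finset.sum_congr rfl fun g _ => ?_
    have hs : sgn (τ * (π + P k)) = sgn (τ * (π + P g)) * sgn (τ * (P g + P k)) := by
      rw [← sgn_add]
      congr 1
      exact (by decide : ∀ a b c d : ZMod 2, a * (b + d) = a * (b + c) + a * (c + d)) _ _ _ _
    rw [hs, scomm_mul_right, hc]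
    simp [mul_assoc]
  simp only [h1, Finset.sum_mul]
  rw [Finset.sum_comm]
  simp only [mul_assoc, ← Finset.mul_sum, hD]
  simp

/-- A superbracket with a column `U`, recovered from those with `D * U`, when the invertible
matrix `D` supercommutes with the given element. -/
lemma scomm_cancel_left {κ : Type*} [Fintype κ] [DecidableEq κ] (P : κ → ZMod 2) (τ π : ZMod 2)
    (z c : R) (hz : ∀ a, z * a = a * z) (D D' : κ → κ → R)
    (hD : ∀ m q, ∑ i, D' m i * D i q = if m = q then 1 else 0)
    (hc : ∀ i q, scomm (sgn ((P i + P q) * τ)) (D i q) c = 0) (U Y : κ → R)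
    (hY : ∀ i, z * scomm (sgn ((P i + π) * τ)) (∑ q, D i q * U q) c = ∑ q, D i q * Y q)
    (m : κ) : z * scomm (sgn ((P m + π) * τ)) (U m) c = Y m := by
  have h1 : ∀ i, ∑ q, D i q * (z * scomm (sgn ((P q + π) * τ)) (U q) c) = ∑ q, D i q * Y q := by
    intro i
    rw [← hY, scomm_sum_left, Finset.mul_sum]
    refine Finset.sum_congr rfl fun q _ => ?_
    have hs : sgn ((P i + π) * τ) = sgn ((P i + P q) * τ) * sgn ((P q + π) * τ) := by
      rw [← sgn_add]
      congr 1
      exact (by decide : ∀ a b c d : ZMod 2, (b + d) * a = (b + c) * a + (c + d) * a) _ _ _ _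
    rw [hs, scomm_mul_left, hc, ← mul_assoc, ← hz]
    simp [mul_assoc]
  have inv : ∀ Z : κ → R, ∑ i, D' m i * ∑ q, D i q * Z q = Z m := by
    intro Z
    simp only [Finset.mul_sum]
    rw [Finset.sum_comm]
    simp only [← mul_assoc, ← Finset.sum_mul, hD]
    simp
  rw [← inv fun q => z * scomm (sgn ((P q + π) * τ)) (U q) c, ← inv Y]
  simp only [h1]

end Superbracket

section TwoVariables

variable [Ring A]

/-- The embedding `f(u) ↦ f(u)` into series in `u⁻¹` (outer variable) and `v⁻¹`. -/
def inU : PowerSeries A →+* PowerSeries (PowerSeries A) := PowerSeries.map PowerSeries.C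

/-- The embedding `f(u) ↦ f(v)` into series in `u⁻¹` and `v⁻¹` (inner variable). -/
def inV : PowerSeries A →+* PowerSeries (PowerSeries A) := PowerSeries.C

variable (A) in
/-- The central element `v⁻¹ - u⁻¹`. -/
def invSub : PowerSeries (PowerSeries A) := PowerSeries.C PowerSeries.X - PowerSeries.X

variable (A) in
/-- The central element `u⁻¹ v⁻¹`. -/
def invMul : PowerSeries (PowerSeries A) := PowerSeries.X * PowerSeries.C PowerSeries.X

/-- The series whose product with `u⁻¹ v⁻¹` is `(u - v)⁻¹ (f(v) - f(u))`. -/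
def dividedDiff (f : PowerSeries A) : PowerSeries (PowerSeries A) :=
  PowerSeries.mk fun r => PowerSeries.mk fun s => PowerSeries.coeff (r + s + 1) f

lemma coeff_inU_mul_inV (f g : PowerSeries A) (r s : ℕ) :
    PowerSeries.coeff s (PowerSeries.coeff r (inU f * inV g)) =
      PowerSeries.coeff r f * PowerSeries.coeff s g := by
  simp [inU, inV]

lemma coeff_inV_mul_inU (f g : PowerSeries A) (r s : ℕ) :
    PowerSeries.coeff s (PowerSeries.coeff r (inV f * inU g)) =
      PowerSeries.coeff s f * PowerSeries.coeff r g := by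
  simp [inU, inV]

lemma C_X_mul (H : PowerSeries (PowerSeries A)) :
    PowerSeries.C PowerSeries.X * H = H * PowerSeries.C PowerSeries.X := by
  ext1 r
  rw [PowerSeries.coeff_C_mul, PowerSeries.coeff_mul_C, PowerSeries.X_mul]

lemma invSub_mul (H : PowerSeries (PowerSeries A)) : invSub A * H = H * invSub A := by
  rw [invSub, sub_mul, mul_sub, C_X_mul, PowerSeries.X_mul]

lemma invMul_mul (H : PowerSeries (PowerSeries A)) : invMul A * H = H * invMul A := by
  rw [invMul, mul_assoc, C_X_mul, PowerSeries.X_mul, mul_assoc, C_X_mul, PowerSeries.X_mul]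

lemma invSub_mul_eq_invMul_mul (H K : PowerSeries (PowerSeries A))
    (h0 : ∀ s, PowerSeries.coeff s (PowerSeries.coeff 0 H) = 0)
    (h0' : ∀ r, PowerSeries.coeff 0 (PowerSeries.coeff r H) = 0)
    (h : ∀ r s, PowerSeries.coeff s (PowerSeries.coeff (r + 1) H) -
      PowerSeries.coeff (s + 1) (PowerSeries.coeff r H) =
        PowerSeries.coeff s (PowerSeries.coeff r K)) :
    invSub A * H = invMul A * K := by
  ext r s
  rw [invSub, invMul, sub_mul, mul_assoc]
  simp only [PowerSeries.coeff_zero_eq_constantCoeff_apply] at h0 h0'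
  rcases r with _ | r <;> rcases s with _ | s <;>
    simp [PowerSeries.coeff_C_mul, PowerSeries.coeff_succ_X_mul, h0, h0', h]

lemma eq_zero_of_invSub_mul {H : PowerSeries (PowerSeries A)} (h : invSub A * H = 0) :
    H = 0 := by
  ext1 r
  rw [invSub, sub_mul, sub_eq_zero] at h
  induction r with
  | zero =>
    have := congrArg (PowerSeries.coeff 0) h
    rw [PowerSeries.coeff_C_mul, PowerSeries.coeff_zero_X_mul] at this
    exact PowerSeries.X_mul_cancel (by rw [this, map_zero, mul_zero])
  | succ r ih =>
    have := congrArg (PowerSeries.coeff (r + 1)) h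
    rw [PowerSeries.coeff_C_mul, PowerSeries.coeff_succ_X_mul, ih] at this
    exact PowerSeries.X_mul_cancel (by rw [this, map_zero, map_zero, mul_zero])

lemma invSub_mul_dividedDiff (f : PowerSeries A) :
    invSub A * dividedDiff f = inV f - inU f := by
  ext r s
  rw [invSub, sub_mul]
  have h0 : PowerSeries.constantCoeff (PowerSeries.map PowerSeries.C f) =
      PowerSeries.C (PowerSeries.constantCoeff f) := by
    rw [← PowerSeries.coeff_zero_eq_constantCoeff_apply, PowerSeries.coeff_map,
      PowerSeries.coeff_zero_eq_constantCoeff_apply]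
  rcases r with _ | r <;> rcases s with _ | s <;>
    simp [PowerSeries.coeff_C_mul, PowerSeries.coeff_succ_X_mul, dividedDiff, inU, inV,
      PowerSeries.coeff_succ_C, PowerSeries.coeff_mk, h0]
  rw [show r + 1 + s + 1 = r + (s + 1) + 1 by omega, sub_self]

lemma eq_zero_of_sum_mul_eq_zero {ι : Type*} [Fintype ι] [DecidableEq ι]
    (T : ι → ι → PowerSeries A)
    (hT : ∀ a g, PowerSeries.coeff 0 (T a g) = if a = g then 1 else 0)
    (Z : ι → PowerSeries A) (hZ : ∀ a, ∑ g, T a g * Z g = 0) (g : ι) : Z g = 0 := by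
  ext n
  rw [map_zero]
  induction n using Nat.strong_induction_on generalizing g with
  | _ n ih =>
    have h := congrArg (PowerSeries.coeff n) (hZ g)
    have hterm : ∀ x, PowerSeries.coeff n (T g x * Z x) =
        (if g = x then 1 else 0) * PowerSeries.coeff n (Z x) := by
      intro x
      rw [PowerSeries.coeff_mul, Finset.sum_eq_single (0, n), hT]
      · rintro ⟨a, b⟩ hab hne
        rw [Finset.HasAntidiagonal.mem_antidiagonal] at hab
        have : b < n := by
          rcases Nat.eq_zero_or_pos a with rfl | ha
          · simp_all
          · simp only at hab
            omega
        simp only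
        rw [ih b this, mul_zero]
      · simp
    simpa [hterm] using h

lemma eq_zero_of_sum_inV_mul_eq_zero {ι : Type*} [Fintype ι] [DecidableEq ι]
    (T : ι → ι → PowerSeries A)
    (hT : ∀ a g, PowerSeries.coeff 0 (T a g) = if a = g then 1 else 0)
    (Z : ι → PowerSeries (PowerSeries A)) (hZ : ∀ a, ∑ g, inV (T a g) * Z g = 0) (g : ι) :
    Z g = 0 := by
  ext1 r
  rw [map_zero]
  refine eq_zero_of_sum_mul_eq_zero T hT (fun g => PowerSeries.coeff r (Z g)) (fun a => ?_) g
  simpa [inV, PowerSeries.coeff_C_mul] using congrArg (PowerSeries.coeff r) (hZ a)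

variable [Algebra ℂ A]

lemma coeff_scomm_inU_inV (ε : ℂ) (f g : PowerSeries A) (r s : ℕ) :
    PowerSeries.coeff s (PowerSeries.coeff r (scomm ε (inU f) (inV g))) =
      scomm ε (PowerSeries.coeff r f) (PowerSeries.coeff s g) := by
  simp only [scomm, map_sub, PowerSeries.coeff_smul, coeff_inU_mul_inV, coeff_inV_mul_inU]

lemma RTT.series_s10 {d : ℕ} {p : ℕ → ZMod 2} (S : RTT A d p) {i j h k : ℕ} (hi : i < d)
    (hj : j < d) (hh : h < d) (hk : k < d) :
    invSub A * scomm (sgn ((p i + p j) * (p h + p k)))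
        (inU (PowerSeries.mk (S.t i j))) (inV (PowerSeries.mk (S.t h k))) =
      invMul A * (sgn (p i * p j + p i * p h + p j * p h) •
        (inU (PowerSeries.mk (S.t h j)) * inV (PowerSeries.mk (S.t i k)) -
          inV (PowerSeries.mk (S.t h j)) * inU (PowerSeries.mk (S.t i k)))) := by
  apply invSub_mul_eq_invMul_mul
  · intro s
    rw [coeff_scomm_inU_inV, PowerSeries.coeff_mk, PowerSeries.coeff_mk,
      S.rtt _ _ _ _ _ _ hi hj hh hk]
    simp
  · intro s
    rw [coeff_scomm_inU_inV, PowerSeries.coeff_mk, PowerSeries.coeff_mk,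
      S.rtt _ _ _ _ _ _ hi hj hh hk]
    simp
  · intro r s
    rw [coeff_scomm_inU_inV, coeff_scomm_inU_inV]
    simp only [PowerSeries.coeff_mk, PowerSeries.coeff_smul, map_sub, coeff_inU_mul_inV,
      coeff_inV_mul_inU, S.rtt _ _ _ _ _ _ hi hj hh hk, ← smul_sub]
    congr 1
    rw [show r + 1 + s - 1 = r + s by omega, show r + (s + 1) - 1 = r + s by omega]
    rcases lt_trichotomy r s with hrs | rfl | hrs
    · rw [min_eq_left (by omega), min_eq_left (by omega), Finset.sum_range_succ,
        add_sub_cancel_left, Nat.add_sub_cancel_left]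
    · rw [min_eq_right (by omega), min_eq_left (by omega), sub_self, sub_self]
    · rw [min_eq_right (by omega), min_eq_right (by omega), Finset.sum_range_succ,
        Nat.add_sub_cancel]
      abel

end TwoVariables

section Blocks

/-- Matrix indices, grouped into three blocks. -/
abbrev Idx (μ : ℕ → ℕ) : Type := Fin (μ 0) ⊕ Fin (μ 1) ⊕ Fin (μ 2)

/-- The block containing an index. -/
def Idx.block {μ : ℕ → ℕ} : Idx μ → ℕ
  | .inl _ => 0
  | .inr (.inl _) => 1
  | .inr (.inr _) => 2

/-- The position of an index inside its block. -/
def Idx.entry {μ : ℕ → ℕ} : Idx μ → ℕ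
  | .inl i => i
  | .inr (.inl i) => i
  | .inr (.inr i) => i

/-- The global position of an index. -/
def Idx.pos {μ : ℕ → ℕ} (x : Idx μ) : ℕ := off μ x.block + x.entry

lemma off_zero (μ : ℕ → ℕ) : off μ 0 = 0 := by simp [off]

lemma off_one (μ : ℕ → ℕ) : off μ 1 = μ 0 := by simp [off]

lemma off_two (μ : ℕ → ℕ) : off μ 2 = μ 0 + μ 1 := by simp [off, Finset.sum_range_succ]

lemma off_three (μ : ℕ → ℕ) : off μ 3 = μ 0 + μ 1 + μ 2 := by
  simp [off, Finset.sum_range_succ]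

lemma Idx.block_lt {μ : ℕ → ℕ} (x : Idx μ) : x.block < 3 := by
  rcases x with i | i | i <;> simp [Idx.block]

lemma Idx.entry_lt {μ : ℕ → ℕ} (x : Idx μ) : x.entry < μ x.block := by
  rcases x with i | i | i <;> simp [Idx.block, Idx.entry]

lemma Idx.pos_lt {μ : ℕ → ℕ} (x : Idx μ) : x.pos < off μ 3 := by
  rw [off_three]
  rcases x with i | i | i <;>
    simp only [Idx.pos, Idx.block, Idx.entry, off_zero, off_one, off_two] <;> omega

lemma Idx.pos_injective {μ : ℕ → ℕ} : Function.Injective (Idx.pos (μ := μ)) := by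
  intro x y h
  rcases x with i | i | i <;> rcases y with j | j | j <;>
    simp only [Idx.pos, Idx.block, Idx.entry, off_zero, off_one, off_two] at h <;>
    first
    | (have h' : i = j := Fin.ext (by omega)
       rw [h'])
    | (exfalso; omega)

lemma coeff_mk_mul_mk [Ring A] (f g : ℕ → A) (r : ℕ) :
    PowerSeries.coeff r (PowerSeries.mk f * PowerSeries.mk g) =
      ∑ e ∈ Finset.range (r + 1), f e * g (r - e) := by
  rw [PowerSeries.coeff_mul]
  simp only [PowerSeries.coeff_mk]
  exact Finset.Nat.sum_antidiagonal_eq_sum_range_succ (fun a b => f a * g b) r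

variable [Ring A] [Algebra ℂ A] {T : ℕ → ℕ → ℕ → A} {μ : ℕ → ℕ} (G : Gauss T 3 μ)

/-- The entries of the block `E_{a,b}` as power series. -/
def Gauss.e (a b i j : ℕ) : PowerSeries A := PowerSeries.mk (G.E a b i j)

/-- The entries of the block `F_{a,b}` as power series. -/
def Gauss.f (a b i j : ℕ) : PowerSeries A := PowerSeries.mk (G.F a b i j)

/-- The entries of the block `D_a` as power series. -/
def Gauss.diag (a i j : ℕ) : PowerSeries A := PowerSeries.mk (G.D a i j)

/-- The entries of the inverse of the block `D_a` as power series. -/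
def Gauss.diagInv (a i j : ℕ) : PowerSeries A := PowerSeries.mk (G.D' a i j)

lemma Gauss.e_self (a i j : ℕ) : G.e a a i j = if i = j then 1 else 0 := by
  ext r
  by_cases h : i = j <;> simp [Gauss.e, G.E_diag, h, PowerSeries.coeff_one]

lemma Gauss.e_low {a b : ℕ} (h : b < a) (i j : ℕ) : G.e a b i j = 0 := by
  ext r
  simp [Gauss.e, G.E_low a b i j r h]

lemma Gauss.f_self (a i j : ℕ) : G.f a a i j = if i = j then 1 else 0 := by
  ext r
  by_cases h : i = j <;> simp [Gauss.f, G.F_diag, h, PowerSeries.coeff_one]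

lemma Gauss.f_high {a b : ℕ} (h : a < b) (i j : ℕ) : G.f a b i j = 0 := by
  ext r
  simp [Gauss.f, G.F_high a b i j r h]

lemma Gauss.diag_mul_diagInv {a i j : ℕ} (ha : a < 3) (hi : i < μ a) (hj : j < μ a) :
    ∑ q : Fin (μ a), G.diag a i q * G.diagInv a q j = if i = j then 1 else 0 := by
  ext r
  rw [map_sum]
  simp only [Gauss.diag, Gauss.diagInv, coeff_mk_mul_mk]
  rw [← Finset.sum_range
    (fun q => ∑ e ∈ Finset.range (r + 1), G.D a i q e * G.D' a q j (r - e)),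
    G.D_inv a i j r ha hi hj]
  by_cases h : i = j <;> simp [h, PowerSeries.coeff_one]

lemma Gauss.diagInv_mul_diag {a i j : ℕ} (ha : a < 3) (hi : i < μ a) (hj : j < μ a) :
    ∑ q : Fin (μ a), G.diagInv a i q * G.diag a q j = if i = j then 1 else 0 := by
  ext r
  rw [map_sum]
  simp only [Gauss.diag, Gauss.diagInv, coeff_mk_mul_mk]
  rw [← Finset.sum_range
    (fun q => ∑ e ∈ Finset.range (r + 1), G.D' a i q e * G.D a q j (r - e)),
    G.D_inv' a i j r ha hi hj]
  by_cases h : i = j <;> simp [h, PowerSeries.coeff_one]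

lemma Gauss.series_decomp {a b i j : ℕ} (ha : a < 3) (hb : b < 3) (hi : i < μ a)
    (hj : j < μ b) :
    PowerSeries.mk (T (off μ a + i) (off μ b + j)) =
      ∑ c ∈ Finset.range 3, ∑ q₁ : Fin (μ c), ∑ q₂ : Fin (μ c),
        G.f a c i q₁ * (G.diag c q₁ q₂ * G.e c b q₂ j) := by
  ext r
  rw [PowerSeries.coeff_mk, G.decomp a b i j r ha hb hi hj, map_sum]
  refine Finset.sum_congr rfl fun c _ => ?_
  rw [Finset.sum_range, map_sum]
  refine Finset.sum_congr rfl fun q₁ _ => ?_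
  rw [Finset.sum_range, map_sum]
  refine Finset.sum_congr rfl fun q₂ _ => ?_
  rw [PowerSeries.coeff_mul]
  simp only [Gauss.f, Gauss.diag, Gauss.e, coeff_mk_mul_mk, PowerSeries.coeff_mk]
  rw [Finset.Nat.sum_antidiagonal_eq_sum_range_succ (fun x y => G.F a c i q₁ x *
    ∑ e ∈ Finset.range (y + 1), G.D c q₁ q₂ e * G.E c b q₂ j (y - e)) r]
  refine Finset.sum_congr rfl fun e he => ?_
  rw [Finset.mem_range] at he
  rw [Finset.mul_sum, show r + 1 - e = r - e + 1 by omega]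
  simp only [mul_assoc]

/-- The last block column of the inverse of the block matrix `E`. -/
def Gauss.eInvCol (x : Idx μ) (k : ℕ) : PowerSeries A :=
  match x with
  | .inl i => ∑ q : Fin (μ 1), G.e 0 1 i q * G.e 1 2 q k - G.e 0 2 i k
  | .inr (.inl i) => -G.e 1 2 i k
  | .inr (.inr i) => if (i : ℕ) = k then 1 else 0

/-- The last block column of the inverse of the matrix `T`. -/
def Gauss.tInvCol (x : Idx μ) (k : ℕ) : PowerSeries A :=
  ∑ l : Fin (μ 2), G.eInvCol x l * G.diagInv 2 l k

lemma sum_fin_ite {R : Type*} [AddCommMonoid R] {n q : ℕ} (hq : q < n) (f : ℕ → R) :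
    ∑ m : Fin n, (if q = m then f m else 0) = f q := by
  rw [Finset.sum_eq_single ⟨q, hq⟩]
  · simp
  · intro b _ hb
    rw [if_neg]
    rintro rfl
    exact hb rfl
  · simp

lemma Gauss.sum_e_mul_eInvCol {c q k : ℕ} (hc : c < 3) (hq : q < μ c) (hk : k < μ 2) :
    ∑ x : Idx μ, G.e c x.block q x.entry * G.eInvCol x k =
      if c = 2 ∧ q = k then 1 else 0 := by
  rw [Fintype.sum_sum_type, Fintype.sum_sum_type]
  simp only [Idx.block, Idx.entry, Gauss.eInvCol]
  have hlast : ∑ x : Fin (μ 2), G.e c 2 q x * (if (x : ℕ) = k then 1 else 0) = G.e c 2 q k := by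
    simp only [eq_comm (b := k), mul_ite, mul_one, mul_zero]
    exact sum_fin_ite hk (fun x => G.e c 2 q x)
  rw [hlast]
  interval_cases c
  · simp only [G.e_self, ite_mul, one_mul, zero_mul]
    rw [sum_fin_ite hq (fun x => ∑ m : Fin (μ 1), G.e 0 1 x m * G.e 1 2 m k - G.e 0 2 x k)]
    simp
  · simp only [G.e_self, G.e_low zero_lt_one, ite_mul, one_mul, zero_mul]
    rw [sum_fin_ite hq (fun x => -G.e 1 2 x k)]
    simp
  · simp [G.e_self, G.e_low]

lemma Gauss.sum_series_mul_tInvCol (x : Idx μ) (k : Fin (μ 2)) :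
    ∑ y : Idx μ, PowerSeries.mk (T x.pos y.pos) * G.tInvCol y k =
      if x = .inr (.inr k) then 1 else 0 := by
  have hE : ∀ c < 3, ∀ q < μ c, ∑ y : Idx μ, G.e c y.block q y.entry * G.tInvCol y k =
      if c = 2 then G.diagInv 2 q k else 0 := by
    intro c hc q hq
    simp only [Gauss.tInvCol, Finset.mul_sum]
    rw [Finset.sum_comm]
    simp only [← mul_assoc, ← Finset.sum_mul]
    rw [Finset.sum_congr rfl fun l _ => by rw [G.sum_e_mul_eInvCol hc hq l.isLt]]
    by_cases h : c = 2
    · subst h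
      simp only [true_and, ite_mul, one_mul, zero_mul, if_true]
      exact sum_fin_ite hq (fun l => G.diagInv 2 l k)
    · simp [h]
  have hrow : ∀ y : Idx μ, PowerSeries.mk (T x.pos y.pos) * G.tInvCol y k =
      ∑ c ∈ Finset.range 3, ∑ q₁ : Fin (μ c), ∑ q₂ : Fin (μ c), G.f x.block c x.entry q₁ *
        (G.diag c q₁ q₂ * (G.e c y.block q₂ y.entry * G.tInvCol y k)) := by
    intro y
    rw [Idx.pos, Idx.pos, G.series_decomp x.block_lt y.block_lt x.entry_lt y.entry_lt]
    simp only [Finset.sum_mul, mul_assoc]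
  simp only [hrow]
  rw [Finset.sum_comm, Finset.sum_eq_single 2]
  · rw [Finset.sum_comm]
    have : ∀ q₁ : Fin (μ 2), ∑ y : Idx μ, ∑ q₂ : Fin (μ 2), G.f x.block 2 x.entry q₁ *
        (G.diag 2 q₁ q₂ * (G.e 2 y.block q₂ y.entry * G.tInvCol y k)) =
        if (k : ℕ) = q₁ then G.f x.block 2 x.entry q₁ else 0 := by
      intro q₁
      rw [Finset.sum_comm]
      simp only [← Finset.mul_sum]
      rw [Finset.sum_congr rfl fun q₂ _ => by
        rw [hE 2 (by norm_num) q₂ q₂.isLt, if_pos rfl],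
        G.diag_mul_diagInv (by norm_num) q₁.isLt k.isLt]
      simp [eq_comm]
    simp only [this]
    rw [sum_fin_ite k.isLt (fun q => G.f x.block 2 x.entry q)]
    rcases x with i | i | i
    · simp [Idx.block, G.f_high]
    · simp [Idx.block, G.f_high]
    · simp [Idx.block, Idx.entry, G.f_self, Fin.ext_iff]
  · intro c hc hc2
    rw [Finset.mem_range] at hc
    rw [Finset.sum_comm]
    refine Finset.sum_eq_zero fun q₁ _ => ?_
    rw [Finset.sum_comm]
    refine Finset.sum_eq_zero fun q₂ _ => ?_
    rw [← Finset.mul_sum, ← Finset.mul_sum, hE c hc q₂ q₂.isLt, if_neg hc2]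
    simp
  · simp

lemma Gauss.series_first_row (i : Fin (μ 0)) (y : Idx μ) :
    PowerSeries.mk (T i y.pos) =
      ∑ q : Fin (μ 0), G.diag 0 i q * G.e 0 y.block q y.entry := by
  have h := G.series_decomp (by norm_num : 0 < 3) y.block_lt i.isLt y.entry_lt
  rw [off_zero, zero_add, Finset.sum_eq_single 0] at h
  · rw [Idx.pos, h]
    simp only [G.f_self, ← Finset.mul_sum]
    simp only [ite_mul, one_mul, zero_mul]
    exact sum_fin_ite i.isLt (fun x => ∑ q : Fin (μ 0), G.diag 0 x q * G.e 0 y.block q y.entry)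
  · intro c _ hc
    simp [G.f_high (Nat.pos_of_ne_zero hc)]
  · simp

end Blocks

section Relations

variable [Ring A]

lemma coeff_invMul_mul (H : PowerSeries (PowerSeries A)) (r s : ℕ) :
    PowerSeries.coeff (s + 1) (PowerSeries.coeff (r + 1) (invMul A * H)) =
      PowerSeries.coeff s (PowerSeries.coeff r H) := by
  rw [invMul, mul_assoc, PowerSeries.coeff_succ_X_mul, PowerSeries.coeff_C_mul,
    PowerSeries.coeff_succ_X_mul]

lemma coeff_dividedDiff_mul_inV (f g : ℕ → A) (r s : ℕ) :
    PowerSeries.coeff s (PowerSeries.coeff r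
        (dividedDiff (PowerSeries.mk f) * inV (PowerSeries.mk g))) =
      ∑ c ∈ Finset.range (s + 1), f (r + c + 1) * g (s - c) := by
  rw [inV, PowerSeries.coeff_mul_C, dividedDiff, PowerSeries.coeff_mk, coeff_mk_mul_mk]
  simp only [PowerSeries.coeff_mk]

variable [Algebra ℂ A] {T : ℕ → ℕ → ℕ → A} {μ : ℕ → ℕ}

lemma Gauss.sum_tInvCol_mul_diag (G : Gauss T 3 μ) (y : Idx μ) (l : Fin (μ 2)) :
    ∑ m : Fin (μ 2), G.tInvCol y m * G.diag 2 m l = G.eInvCol y l := by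
  simp only [Gauss.tInvCol, Finset.sum_mul]
  rw [Finset.sum_comm]
  simp only [mul_assoc, ← Finset.mul_sum]
  rw [Finset.sum_congr rfl fun m _ => by
    rw [G.diagInv_mul_diag (by norm_num) m.isLt l.isLt]]
  simp [← Fin.ext_iff]

lemma Gauss.tInvCol_last (G : Gauss T 3 μ) (m l : Fin (μ 2)) :
    G.tInvCol (.inr (.inr m)) l = G.diagInv 2 m l := by
  simp [Gauss.tInvCol, Gauss.eInvCol, ← Fin.ext_iff]

lemma Gauss.series_mul_tInvCol_mul_diag (G : Gauss T 3 μ) (i : Fin (μ 0)) (l : Fin (μ 2)) :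
    ∑ m : Fin (μ 2), (∑ y : Idx μ, inU (PowerSeries.mk (T i y.pos)) * inV (G.tInvCol y m)) *
        inV (G.diag 2 m l) =
      ∑ q : Fin (μ 0), inU (G.diag 0 i q) *
        ∑ y : Idx μ, inU (G.e 0 y.block q y.entry) * inV (G.eInvCol y l) := by
  simp only [Finset.sum_mul]
  rw [Finset.sum_comm]
  simp only [mul_assoc, ← map_mul, ← Finset.mul_sum]
  simp only [← map_sum, G.sum_tInvCol_mul_diag, G.series_first_row]
  simp only [map_sum, map_mul, Finset.sum_mul, Finset.mul_sum, mul_assoc]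
  exact Finset.sum_comm

lemma Gauss.sum_inU_e_mul_inV_eInvCol (G : Gauss T 3 μ) (q : Fin (μ 0)) (l : Fin (μ 2)) :
    ∑ y : Idx μ, inU (G.e 0 y.block q y.entry) * inV (G.eInvCol y l) =
      -(invSub A * (dividedDiff (G.e 0 2 q l) -
        ∑ m : Fin (μ 1), dividedDiff (G.e 0 1 q m) * inV (G.e 1 2 m l))) := by
  rw [mul_sub, Finset.mul_sum]
  simp only [← mul_assoc, invSub_mul_dividedDiff]
  rw [Fintype.sum_sum_type, Fintype.sum_sum_type]
  simp only [Idx.block, Idx.entry, Gauss.eInvCol, G.e_self, ← Fin.ext_iff]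
  simp only [apply_ite inU, apply_ite inV, map_one, map_zero, ite_mul, mul_ite, one_mul,
    zero_mul, mul_one, mul_zero, Finset.sum_ite_eq, Finset.sum_ite_eq', Finset.mem_univ, if_true]
  simp only [map_sub, map_sum, map_mul, map_neg, mul_neg, sub_mul, Finset.sum_sub_distrib,
    Finset.sum_neg_distrib]
  abel

variable {d : ℕ} {p : ℕ → ZMod 2}

lemma scomm_series_tInvCol (S : RTT A d p) (G : Gauss S.t 3 μ) (hd : off μ 3 = d)
    (x y g : Idx μ) (l : Fin (μ 2)) (hx : x ≠ .inr (.inr l)) :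
    invSub A * scomm
        (sgn ((p x.pos + p y.pos) * (p g.pos + p (Idx.pos (μ := μ) (.inr (.inr l))))))
        (inU (PowerSeries.mk (S.t x.pos y.pos))) (inV (G.tInvCol g l)) =
      if g = y then invMul A * (sgn (p y.pos) •
        ∑ q : Idx μ, inU (PowerSeries.mk (S.t x.pos q.pos)) * inV (G.tInvCol q l)) else 0 := by
  subst hd
  refine scomm_inverse_column (fun x : Idx μ => p x.pos) (invSub A) (invMul A) invSub_mul
    invMul_mul (fun x y => inU (PowerSeries.mk (S.t x.pos y.pos)))
    (fun x y => inV (PowerSeries.mk (S.t x.pos y.pos)))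
    (fun i j h k => S.series_s10 i.pos_lt j.pos_lt h.pos_lt k.pos_lt)
    (fun g => inV (G.tInvCol g l)) (.inr (.inr l)) (fun a => ?_) (fun Z hZ => ?_) x y g hx
  · simp only [← map_mul, ← map_sum, G.sum_series_mul_tInvCol, apply_ite inV, map_one, map_zero]
  · refine eq_zero_of_sum_inV_mul_eq_zero
      (fun x y : Idx μ => PowerSeries.mk (S.t x.pos y.pos)) (fun a b => ?_) Z hZ
    simp only [PowerSeries.coeff_mk, S.t_zero, Idx.pos_injective.eq_iff]

lemma scomm_series_e (S : RTT A d p) (G : Gauss S.t 3 μ) (hd : off μ 3 = d)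
    (i : Fin (μ 0)) (y : Idx μ) (hy : ∀ m, y ≠ .inr (.inr m)) (h : Fin (μ 1)) (l : Fin (μ 2)) :
    invSub A * scomm
        (sgn ((p (Idx.pos (μ := μ) (.inl i)) + p y.pos) *
          (p (Idx.pos (μ := μ) (.inr (.inl h))) + p (Idx.pos (μ := μ) (.inr (.inr l))))))
        (inU (PowerSeries.mk (S.t (Idx.pos (μ := μ) (.inl i)) y.pos))) (inV (G.e 1 2 h l)) =
      if Sum.inr (Sum.inl h) = y then invMul A * (sgn (p y.pos) •
        ∑ q : Fin (μ 0), inU (G.diag 0 i q) * (invSub A * (dividedDiff (G.e 0 2 q l) -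
          ∑ m : Fin (μ 1), dividedDiff (G.e 0 1 q m) * inV (G.e 1 2 m l)))) else 0 := by
  have hcol := fun g m => scomm_series_tInvCol S G hd (.inl i) y g m (by simp)
  have key := scomm_cancel_right (fun m : Fin (μ 2) => p (Idx.pos (μ := μ) (.inr (.inr m))))
    (p (Idx.pos (μ := μ) (.inl i)) + p y.pos) (p (Idx.pos (μ := μ) (.inr (.inl h))))
    (invSub A) (inU (PowerSeries.mk (S.t (Idx.pos (μ := μ) (.inl i)) y.pos)))
    (fun m l => inV (G.diag 2 m l)) (fun m l => inV (G.diagInv 2 m l))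
    (fun m l => by
      simp only [← map_mul, ← map_sum, G.diagInv_mul_diag (show 2 < 3 by norm_num) m.isLt l.isLt,
        apply_ite inV, map_one, map_zero, Fin.ext_iff])
    (fun m l => by
      apply eq_zero_of_invSub_mul
      rw [← G.tInvCol_last, hcol, if_neg (fun h => hy m h.symm)])
    (fun m => inV (G.eInvCol (.inr (.inl h)) m)) _
    (fun m => by
      simp only [← map_mul, ← map_sum]
      exact hcol (.inr (.inl h)) m) l
  have hneg : inV (G.eInvCol (.inr (.inl h)) l) = -inV (G.e 1 2 h l) := map_neg _ _
  rw [hneg, scomm_neg_right, mul_neg, neg_eq_iff_eq_neg] at key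
  rw [key]
  split_ifs with hhy
  · have h0 : Idx.pos (μ := μ) (.inl i) = i := by simp [Idx.pos, Idx.block, Idx.entry, off_zero]
    simp only [mul_assoc, smul_mul_assoc]
    rw [← Finset.mul_sum, ← Finset.smul_sum, h0, G.series_mul_tInvCol_mul_diag]
    simp only [G.sum_inU_e_mul_inV_eInvCol, mul_neg, Finset.sum_neg_distrib, smul_neg, neg_neg]
  · simp

lemma scomm_e_e (S : RTT A d p) (G : Gauss S.t 3 μ) (hd : off μ 3 = d)
    (i : Fin (μ 0)) (j h : Fin (μ 1)) (l : Fin (μ 2)) :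
    scomm
        (sgn ((p (Idx.pos (μ := μ) (.inl i)) + p (Idx.pos (μ := μ) (.inr (.inl j)))) *
          (p (Idx.pos (μ := μ) (.inr (.inl h))) + p (Idx.pos (μ := μ) (.inr (.inr l))))))
        (inU (G.e 0 1 i j)) (inV (G.e 1 2 h l)) =
      if h = j then invMul A * (sgn (p (Idx.pos (μ := μ) (.inr (.inl j)))) •
        (dividedDiff (G.e 0 2 i l) -
          ∑ m : Fin (μ 1), dividedDiff (G.e 0 1 i m) * inV (G.e 1 2 m l))) else 0 := by
  have hpos : ∀ i : Fin (μ 0), Idx.pos (μ := μ) (.inl i) = i := fun i => by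
    simp [Idx.pos, Idx.block, Idx.entry, off_zero]
  have hdiag : ∀ i b : Fin (μ 0),
      PowerSeries.mk (S.t (Idx.pos (μ := μ) (.inl i)) (Idx.pos (μ := μ) (.inl b))) =
        G.diag 0 i b := fun i b => by
    rw [hpos, G.series_first_row]
    simp [Idx.block, Idx.entry, G.e_self, ← Fin.ext_iff]
  have key := scomm_cancel_left (fun i : Fin (μ 0) => p (Idx.pos (μ := μ) (.inl i)))
    (p (Idx.pos (μ := μ) (.inr (.inl h))) + p (Idx.pos (μ := μ) (.inr (.inr l))))
    (p (Idx.pos (μ := μ) (.inr (.inl j)))) (invSub A) (inV (G.e 1 2 h l)) invSub_mul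
    (fun m l => inU (G.diag 0 m l)) (fun m l => inU (G.diagInv 0 m l))
    (fun m l => by
      simp only [← map_mul, ← map_sum, G.diagInv_mul_diag (show 0 < 3 by norm_num) m.isLt l.isLt,
        apply_ite inU, map_one, map_zero, Fin.ext_iff])
    (fun a b => by
      apply eq_zero_of_invSub_mul
      rw [← hdiag, scomm_series_e S G hd a (.inl b) (by simp), if_neg (by simp)])
    (fun q => inU (G.e 0 1 q j))
    (fun q => invSub A * if h = j then
      invMul A * (sgn (p (Idx.pos (μ := μ) (.inr (.inl j)))) •
        (dividedDiff (G.e 0 2 q l) -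
          ∑ m : Fin (μ 1), dividedDiff (G.e 0 1 q m) * inV (G.e 1 2 m l))) else 0)
    (fun a => by
      have h1 := scomm_series_e S G hd a (.inr (.inl j)) (by simp) h l
      have h2 := G.series_first_row a (.inr (.inl j))
      rw [← hpos a] at h2
      simp only [Idx.block, Idx.entry] at h2
      rw [h2, map_sum] at h1
      simp only [map_mul, hpos] at h1 ⊢
      rw [h1]
      simp only [Sum.inr.injEq, Sum.inl.injEq]
      split_ifs
      · rw [Finset.smul_sum, Finset.mul_sum]
        refine Finset.sum_congr rfl fun q _ => ?_
        rw [mul_smul_comm, mul_smul_comm, mul_smul_comm, mul_smul_comm, ← mul_assoc, invMul_mul,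
          mul_assoc, ← mul_assoc (invMul A), ← invSub_mul (invMul A), mul_assoc (invSub A)]
      · simp) i
  rw [← sub_eq_zero]
  apply eq_zero_of_invSub_mul
  rw [mul_sub, key, sub_self]

end Relations

/-- For `μ = (μ 0, μ 1, μ 2)`, one has
`[E_{1;i,j}(u), E_{2;h,k}(v)] = (-1)^{|j|₂|h|₂} δ_{hj} (u-v)^{-1}
( Σ_q (E_{1;i,q}(u) - E_{1;i,q}(v)) E_{2;q,k}(v) + E_{1,3;i,k}(v) - E_{1,3;i,k}(u) )`,
stated as the equality of the coefficients of `u^{-r} v^{-s}` for `r, s ≥ 1`,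
using the expansion `(S(v)-S(u))/(u-v) = Σ_{r,s≥1} S^{(r+s-1)} u^{-r} v^{-s}`. -/
theorem statement10 [Ring A] [Algebra ℂ A] {d : ℕ} {p : ℕ → ZMod 2} {μ : ℕ → ℕ}
    (S : RTT A d p) (G : Gauss S.t 3 μ) (hd : off μ 3 = d) :
    ∀ i j h k r s : ℕ, i < μ 0 → j < μ 1 → h < μ 1 → k < μ 2 →
      scomm (sgn ((p i + p (μ 0 + j)) * (p (μ 0 + h) + p (μ 0 + μ 1 + k))))
          (G.E 0 1 i j (r + 1)) (G.E 1 2 h k (s + 1)) =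
        sgn (p (μ 0 + j) * p (μ 0 + h)) •
          (if h = j then
            G.E 0 2 i k (r + s + 1) -
              ∑ q ∈ Finset.range (μ 1), ∑ c ∈ Finset.range (s + 1),
                G.E 0 1 i q (r + 1 + c) * G.E 1 2 q k (s - c)
           else 0) := by
  intro i j h k r s hi hj hh hk
  have hP0 : ∀ i : Fin (μ 0), Idx.pos (μ := μ) (.inl i) = i := fun i => by
    simp [Idx.pos, Idx.block, Idx.entry, off_zero]
  have hP1 : ∀ i : Fin (μ 1), Idx.pos (μ := μ) (.inr (.inl i)) = μ 0 + i := fun i => by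
    simp [Idx.pos, Idx.block, Idx.entry, off_one]
  have hP2 : ∀ i : Fin (μ 2), Idx.pos (μ := μ) (.inr (.inr i)) = μ 0 + μ 1 + i := fun i => by
    simp [Idx.pos, Idx.block, Idx.entry, off_two]
  have hmain := scomm_e_e S G hd ⟨i, hi⟩ ⟨j, hj⟩ ⟨h, hh⟩ ⟨k, hk⟩
  rw [hP0, hP1, hP1, hP2] at hmain
  have hcoeff := congrArg
    (fun H => PowerSeries.coeff (s + 1) (PowerSeries.coeff (r + 1) H)) hmain
  simp only [coeff_scomm_inU_inV] at hcoeff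
  simp only [Gauss.e, PowerSeries.coeff_mk] at hcoeff
  rw [hcoeff]
  by_cases hjh : h = j
  · subst hjh
    have hs : p (μ 0 + h) * p (μ 0 + h) = p (μ 0 + h) :=
      (by decide : ∀ a : ZMod 2, a * a = a) _
    rw [if_pos rfl, if_pos rfl, hs, coeff_invMul_mul, PowerSeries.coeff_smul,
      PowerSeries.coeff_smul, map_sub, map_sub, map_sum, map_sum, Finset.sum_range]
    simp only [coeff_dividedDiff_mul_inV]
    simp only [dividedDiff, PowerSeries.coeff_mk, add_right_comm r 1]
  · rw [if_neg (by simpa using hjh), if_neg hjh]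
    simp

end SuperYangian
end
end
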